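/- arXiv:1802.00783 — 15 statements merged into one kernel-verified Lean document; each statement's English description precedes it below -/
import Mathlib

section
/- Let G be a simple graph on n vertices and let F be a simple graph on a finite vertex set with |V_F| < n. Then the total number of copies of F in the vertex-deleted subgraphs of G equals (n − |V_F|) times the number of copies of F in G; that is, ∑_{j ∈ V(G)} (number of copies of F in G_j) = (n − |V_F|) · (number of copies of F in G). -/
/-- The number of copies of `F` in `H`: the number of injective graph
homomorphisms from `F` to `H`. -/
noncomputable def numCopies {α β : Type} (F : SimpleGraph α) (H : SimpleGraph β) : ℕ :=
  Nat.card {f : F →g H // Function.Injective ⇑f}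

/-- Copies of `F` in the subgraph of `G` induced on `s` correspond to the copies of `F` in `G`
whose image lies in `s`. -/
theorem numCopies_induce {α β : Type} (F : SimpleGraph α) (G : SimpleGraph β) (s : Set β) :
    numCopies F (G.induce s) =
      Nat.card {f : {f : F →g G // Function.Injective ⇑f} // ∀ x, f.1 x ∈ s} :=
  Nat.card_congr
    { toFun := fun f =>
        ⟨⟨⟨fun x => (f.1 x).1, fun h => f.1.map_rel h⟩,
          fun _ _ h => f.2 (Subtype.ext h)⟩, fun x => (f.1 x).2⟩
      invFun := fun f =>
        ⟨⟨fun x => ⟨f.1.1 x, f.2 x⟩, fun h => f.1.1.map_rel h⟩,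
          fun _ _ h => f.1.2 (congrArg Subtype.val h)⟩
      left_inv := fun _ => rfl
      right_inv := fun _ => rfl }

/-- The number of points missed by an injective map between finite types. -/
theorem card_filter_forall_ne_of_injective {α β : Type*} [Fintype α] [Fintype β] [DecidableEq β]
    {f : α → β} (hf : Function.Injective f) :
    (Finset.univ.filter fun b => ∀ a, f a ≠ b).card = Fintype.card β - Fintype.card α := by
  have h : (Finset.univ.filter fun b => ∀ a, f a ≠ b) = (Finset.univ.image f)ᶜ := by
    ext b
    simp
  rw [h, Finset.card_compl, Finset.card_image_of_injective _ hf, Finset.card_univ]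

/-- Each copy of a graph `F` with fewer than `n` vertices occurs in exactly
`n - |V_F|` of the vertex-deleted subgraphs of an `n`-vertex graph `G`;
hence the total count of copies of `F` over the deck equals
`(n - |V_F|)` times the number of copies of `F` in `G`. -/
theorem deck_copy_count {n : ℕ} {V : Type} [Fintype V]
    (G : SimpleGraph (Fin n)) (F : SimpleGraph V) (hF : Fintype.card V < n) :
    ∑ j : Fin n, numCopies F (G.induce {v : Fin n | v ≠ j})
      = (n - Fintype.card V) * numCopies F G := by
  classical
  have : Finite (F →g G) := Finite.of_injective _ DFunLike.coe_injective
  let _ := Fintype.ofFinite {f : F →g G // Function.Injective ⇑f}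
  have key := Finset.sum_card_bipartiteAbove_eq_sum_card_bipartiteBelow
    (s := (Finset.univ : Finset (Fin n)))
    (t := (Finset.univ : Finset {f : F →g G // Function.Injective ⇑f}))
    (fun j f => ∀ x, f.1 x ≠ j)
  simp only [Finset.bipartiteAbove, Finset.bipartiteBelow,
    fun f : {f : F →g G // Function.Injective ⇑f} => card_filter_forall_ne_of_injective f.2,
    Fintype.card_fin, Finset.sum_const, smul_eq_mul, Finset.card_univ] at key
  simp only [numCopies_induce, Set.mem_ofPred_eq]
  rw [numCopies, Nat.card_eq_fintype_card, mul_comm, ← key]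
  refine Finset.sum_congr rfl fun j _ => ?_
  rw [Nat.card_eq_fintype_card, Fintype.card_subtype]
end

section
/- (Kelly's condition.) Let G be a simple graph on n vertices and let F be a simple graph on a finite vertex set with |V_F| < n. Then n − |V_F| divides ∑_{j ∈ V(G)} (number of copies of F in G_j), the total count of copies of F over the deck of vertex-deleted subgraphs of G. Consequently, any putative deck for which this divisibility fails for some graph F is illegitimate, i.e. cannot arise as the deck of vertex-deleted subgraphs of any n-vertex graph. -/
/-- Copies of `F` in the subgraph of `G` induced on `s` correspond to the copies of `F` in `G`
whose image lies in `s`. -/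
def copiesInduceEquiv {α β : Type} (F : SimpleGraph α) (G : SimpleGraph β) (s : Set β) :
    {f : F →g G.induce s // Function.Injective ⇑f} ≃
      {f : {f : F →g G // Function.Injective ⇑f} // ∀ a, f.1 a ∈ s} where
  toFun f := ⟨⟨⟨fun a => (f.1 a).1, fun h => f.1.map_rel h⟩,
    Subtype.val_injective.comp f.2⟩, fun a => (f.1 a).2⟩
  invFun f := ⟨⟨fun a => ⟨f.1.1 a, f.2 a⟩, fun h => f.1.1.map_rel h⟩,
    fun _ _ h => f.1.2 (congrArg Subtype.val h)⟩
  left_inv _ := rfl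
  right_inv _ := rfl

/-- An injective map misses exactly `|β| - |α|` points of its codomain. -/
theorem card_forall_ne_of_injective {α β : Type} [Fintype α] [Fintype β] {f : α → β}
    (hf : Function.Injective f) :
    Nat.card {b : β // ∀ a, f a ≠ b} = Fintype.card β - Fintype.card α := by
  classical
  rw [Nat.card_eq_fintype_card, Fintype.card_subtype, ← Finset.card_univ (α := α),
    ← Finset.card_image_of_injective Finset.univ hf, ← Finset.card_compl]
  congr 1
  ext b
  simp

/-- Kelly's lemma: each copy of `F` in `G` survives in exactly `|β| - |α|` of the
vertex-deleted subgraphs of `G`. -/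
theorem sum_numCopies_induce_ne {α β : Type} [Fintype α] [Fintype β]
    (F : SimpleGraph α) (G : SimpleGraph β) :
    ∑ j : β, numCopies F (G.induce {v : β | v ≠ j}) =
      numCopies F G * (Fintype.card β - Fintype.card α) := by
  classical
  have : Finite (F →g G) := DFunLike.finite _
  have := Fintype.ofFinite {f : F →g G // Function.Injective ⇑f}
  calc ∑ j : β, numCopies F (G.induce {v : β | v ≠ j})
      = ∑ j : β, Nat.card {f : {f : F →g G // Function.Injective ⇑f} // ∀ a, f.1 a ≠ j} :=
        Finset.sum_congr rfl fun j _ => Nat.card_congr (copiesInduceEquiv F G {v | v ≠ j})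
    _ = ∑ f : {f : F →g G // Function.Injective ⇑f}, Nat.card {j : β // ∀ a, f.1 a ≠ j} := by
        simp only [Nat.card_eq_fintype_card, Fintype.card_subtype]
        exact Finset.sum_card_bipartiteAbove_eq_sum_card_bipartiteBelow
          fun (j : β) (f : {f : F →g G // Function.Injective ⇑f}) => ∀ a, f.1 a ≠ j
    _ = numCopies F G * (Fintype.card β - Fintype.card α) := by
        rw [Finset.sum_congr rfl fun f _ => card_forall_ne_of_injective f.2]
        simp [numCopies]

/-- Kelly's condition: for any graph `F` on fewer than `n` vertices, the total
number of copies of `F` appearing in the deck of vertex-deleted subgraphs of an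
`n`-vertex graph `G` is divisible by `n - |V_F|`.  A putative deck failing this
divisibility for some `F` is illegitimate. -/
theorem kelly_condition {n : ℕ} {V : Type} [Fintype V]
    (G : SimpleGraph (Fin n)) (F : SimpleGraph V) (hF : Fintype.card V < n) :
    (n - Fintype.card V) ∣ ∑ j : Fin n, numCopies F (G.induce {v : Fin n | v ≠ j}) := by
  rw [sum_numCopies_induce_ne, Fintype.card_fin]
  exact dvd_mul_left _ _
end

section
/- For every simple graph G on Fin n, the explicitly defined graph state vector |G⟩ is a common eigenvector with eigenvalue +1 of all n stabilizer generators: for every vertex i and every x : Fin n → Fin 2, (−1)^{∑_{j ∈ N(i)} x_j} · |G⟩(x ⊕ e_i) = |G⟩(x), where x ⊕ e_i denotes x with the i-th bit flipped and N(i) is the neighborhood of i in G. Equivalently, the matrix g_i = X_i ⊗ ⨂_{j ∈ N(i)} Z_j (acting as X on qubit i, Z on each neighbor of i, and identity elsewhere) satisfies g_i |G⟩ = |G⟩ for all i. -/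
open Finset

/-- `qG G x` is the number of edges `{i,j}` of `G` with `x i = x j = 1`. -/
noncomputable def qG {V : Type} (G : SimpleGraph V) (x : V → Fin 2) : ℕ :=
  {e ∈ G.edgeSet | ∀ v ∈ e, x v = 1}.ncard

/-- The graph state vector of a simple graph `G`:
`|G⟩(x) = 2^{-n/2} · (-1)^{q_G(x)}`. -/
noncomputable def graphStateVec {V : Type} [Fintype V] (G : SimpleGraph V)
    (x : V → Fin 2) : ℂ :=
  ((Real.sqrt 2 : ℂ) ^ Fintype.card V)⁻¹ * (-1) ^ qG G x

lemma qG_eq_qG_update_zero_add_sum {V : Type} [Fintype V] [DecidableEq V] (G : SimpleGraph V)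
    [DecidableRel G.Adj] (i : V) (x : V → Fin 2) (hi : x i = 1) :
    qG G x = qG G (Function.update x i 0) + ∑ j ∈ G.neighborFinset i, (x j : ℕ) := by
  have hunion : {e ∈ G.edgeSet | ∀ v ∈ e, x v = 1} =
      {e ∈ G.edgeSet | ∀ v ∈ e, Function.update x i 0 v = 1} ∪
        (fun j => s(i, j)) '' {j | G.Adj i j ∧ x j = 1} := by
    ext e
    induction e using Sym2.ind with
    | _ a b =>
      simp only [Set.mem_ofPred_eq, Set.mem_union, Set.mem_image, Sym2.mem_iff,
        forall_eq_or_imp, forall_eq, SimpleGraph.mem_edgeSet, Sym2.eq_iff, Function.update_apply]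
      have := G.adj_comm a b
      by_cases ha : a = i <;> by_cases hb : b = i <;> grind
  have hdisj : Disjoint {e ∈ G.edgeSet | ∀ v ∈ e, Function.update x i 0 v = 1}
      ((fun j => s(i, j)) '' {j | G.Adj i j ∧ x j = 1}) := by
    rw [Set.disjoint_left]
    rintro _ ⟨-, h⟩ ⟨j, -, rfl⟩
    simpa using h i (Sym2.mem_mk_left i j)
  have hinj : Function.Injective fun j => s(i, j) := fun _ _ h => Sym2.congr_right.mp h
  have hsum : ∑ j ∈ G.neighborFinset i, (x j : ℕ) = {j | G.Adj i j ∧ x j = 1}.ncard := by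
    have hset : {j | G.Adj i j ∧ x j = 1} = ↑{j ∈ G.neighborFinset i | x j = 1} := by
      ext j
      simp
    rw [hset, Set.ncard_coe_finset, Finset.card_filter]
    refine Finset.sum_congr rfl fun j _ => ?_
    generalize x j = b
    fin_cases b <;> rfl
  rw [qG, hunion, Set.ncard_union_eq hdisj (Set.toFinite _) (Set.toFinite _),
    Set.ncard_image_of_injective _ hinj, hsum, qG]

/-- The graph state is a common `+1`-eigenvector of the stabilizer generators
`g_i = X_i ⊗ ⨂_{j ∈ N(i)} Z_j`: for every vertex `i` and every `x`,
`(-1)^{∑_{j ∈ N(i)} x_j} · |G⟩(x ⊕ e_i) = |G⟩(x)`, where `x ⊕ e_i` is `x` with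
the `i`-th bit flipped. -/
theorem graphState_stabilized {n : ℕ} (G : SimpleGraph (Fin n)) [DecidableRel G.Adj]
    (i : Fin n) (x : Fin n → Fin 2) :
    (-1 : ℂ) ^ (∑ j ∈ G.neighborFinset i, (x j : ℕ)) *
        graphStateVec G (Function.update x i (x i + 1))
      = graphStateVec G x := by
  simp only [graphStateVec]
  rw [mul_left_comm]
  congr 1
  obtain hi | hi : x i = 0 ∨ x i = 1 := by
    generalize x i = b
    fin_cases b <;> simp
  · have h := qG_eq_qG_update_zero_add_sum G i (Function.update x i 1) (by simp)
    have hs : ∑ j ∈ G.neighborFinset i, (Function.update x i 1 j : ℕ) =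
        ∑ j ∈ G.neighborFinset i, (x j : ℕ) := by
      refine Finset.sum_congr rfl fun j hj => ?_
      rw [Function.update_of_ne ((G.mem_neighborFinset i j).mp hj).ne']
    rw [Function.update_idem, hs, ← hi, Function.update_eq_self] at h
    rw [hi, zero_add, ← pow_add]
    rw [h, add_left_comm, pow_add, ← two_mul, pow_mul]
    simp
  · rw [qG_eq_qG_update_zero_add_sum G i x hi, hi, ← pow_add, add_comm]
    rfl
end

section
/- Let G be a simple graph on Fin n and j a vertex. Then the partial trace of the graph state density matrix over qubit j is the equal mixture of two rank-one projectors: tr_j(|G⟩⟨G|) = (1/2)(|G_j⟩⟨G_j| + |S_j⟩⟨S_j|), where |G_j⟩ is the graph state vector of the vertex-deleted subgraph G_j (on the remaining n−1 qubits), and |S_j⟩ is the vertex-shrunken state defined by |S_j⟩(x) = (−1)^{∑_{i ∈ N(j)} x_i} · |G_j⟩(x), with N(j) the neighborhood of j in G. -/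
open Finset

/-- The graph state density matrix `|G⟩⟨G|`. -/
noncomputable def graphStateDM {V : Type} [Fintype V] (G : SimpleGraph V) :
    Matrix (V → Fin 2) (V → Fin 2) ℂ :=
  Matrix.of fun x y => graphStateVec G x * (starRingEnd ℂ) (graphStateVec G y)

/-- Extend an assignment on the vertices other than `j` by the value `b` at `j`. -/
def insertAt {n : ℕ} (j : Fin n) (a : {v : Fin n // v ≠ j} → Fin 2) (b : Fin 2) :
    Fin n → Fin 2 :=
  fun v => if h : v = j then b else a ⟨v, h⟩

/-- The partial trace over qubit `j` of an `n`-qubit operator. -/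
noncomputable def ptraceQubit {n : ℕ} (j : Fin n)
    (ρ : Matrix (Fin n → Fin 2) (Fin n → Fin 2) ℂ) :
    Matrix ({v : Fin n // v ≠ j} → Fin 2) ({v : Fin n // v ≠ j} → Fin 2) ℂ :=
  Matrix.of fun a a' => ∑ b : Fin 2, ρ (insertAt j a b) (insertAt j a' b)

/-- The vertex-deleted subgraph `G_j`: the subgraph of `G` induced on the
vertices other than `j`. -/
def vertexDeleted {n : ℕ} (G : SimpleGraph (Fin n)) (j : Fin n) :
    SimpleGraph {v : Fin n // v ≠ j} :=
  SimpleGraph.comap (fun v => (v : Fin n)) G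

/-- The vertex-shrunken state `|S_j⟩(x) = (-1)^{∑_{i ∈ N(j)} x_i} · |G_j⟩(x)`. -/
noncomputable def shrunkenVec {n : ℕ} (G : SimpleGraph (Fin n)) (j : Fin n)
    (x : {v : Fin n // v ≠ j} → Fin 2) : ℂ :=
  (-1) ^ ({i : {v : Fin n // v ≠ j} | G.Adj j ↑i ∧ x i = 1}.ncard) *
    graphStateVec (vertexDeleted G j) x

theorem insertAt_self {n : ℕ} (j : Fin n) (a : {v : Fin n // v ≠ j} → Fin 2) (b : Fin 2) :
    insertAt j a b j = b := by
  simp [insertAt]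

theorem insertAt_coe {n : ℕ} (j : Fin n) (a : {v : Fin n // v ≠ j} → Fin 2) (b : Fin 2)
    (v : {v : Fin n // v ≠ j}) : insertAt j a b v = a v := by
  simp [insertAt, v.2]

theorem insertAt_of_ne {n : ℕ} {j v : Fin n} (a : {v : Fin n // v ≠ j} → Fin 2) (b : Fin 2)
    (h : v ≠ j) : insertAt j a b v = a ⟨v, h⟩ :=
  insertAt_coe j a b ⟨v, h⟩

/-- The fully occupied edges of `G` avoiding `j` are those of the vertex-deleted subgraph. -/
theorem occupiedEdges_avoiding {n : ℕ} (G : SimpleGraph (Fin n)) (j : Fin n)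
    (a : {v : Fin n // v ≠ j} → Fin 2) (b : Fin 2) :
    {e ∈ G.edgeSet | (∀ v ∈ e, insertAt j a b v = 1) ∧ j ∉ e}
      = Sym2.map Subtype.val '' {e ∈ (vertexDeleted G j).edgeSet | ∀ v ∈ e, a v = 1} := by
  ext e
  constructor
  · induction e with | _ u w
    rintro ⟨hG, h1, hj⟩
    simp only [Sym2.mem_iff, not_or] at hj
    have hu : u ≠ j := Ne.symm hj.1
    have hw : w ≠ j := Ne.symm hj.2
    refine ⟨s(⟨u, hu⟩, ⟨w, hw⟩), ⟨hG, ?_⟩, rfl⟩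
    intro v hv
    rw [← insertAt_coe j a b v]
    apply h1
    rcases Sym2.mem_iff.1 hv with rfl | rfl <;> simp
  · rintro ⟨e, ⟨hG, h1⟩, rfl⟩
    induction e with | _ u w
    refine ⟨hG, ?_, ?_⟩
    · intro v hv
      rw [Sym2.map_mk, Sym2.mem_iff] at hv
      rcases hv with rfl | rfl <;> rw [insertAt_coe] <;> apply h1 <;> simp
    · rw [Sym2.map_mk, Sym2.mem_iff]
      rintro (h | h)
      exacts [u.2 h.symm, w.2 h.symm]

/-- The fully occupied edges of `G` through an occupied vertex `j` correspond to its occupied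
neighbours. -/
theorem occupiedEdges_through {n : ℕ} (G : SimpleGraph (Fin n)) (j : Fin n)
    (a : {v : Fin n // v ≠ j} → Fin 2) :
    {e ∈ G.edgeSet | (∀ v ∈ e, insertAt j a 1 v = 1) ∧ j ∈ e}
      = (fun i : {v : Fin n // v ≠ j} => s(j, (i : Fin n))) ''
        {i : {v : Fin n // v ≠ j} | G.Adj j ↑i ∧ a i = 1} := by
  ext e
  constructor
  · rintro ⟨hG, h1, hj⟩
    obtain ⟨w, rfl⟩ := hj
    have hw : w ≠ j := (G.ne_of_adj hG).symm
    refine ⟨⟨w, hw⟩, ⟨hG, ?_⟩, rfl⟩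
    rw [← insertAt_of_ne a 1 hw]
    exact h1 w (Sym2.mem_mk_right j w)
  · rintro ⟨i, ⟨hG, hi⟩, rfl⟩
    refine ⟨hG, ?_, Sym2.mem_mk_left j _⟩
    intro v hv
    rcases Sym2.mem_iff.1 hv with rfl | rfl
    · exact insertAt_self _ a 1
    · rw [insertAt_coe, hi]

theorem qG_insertAt_zero {n : ℕ} (G : SimpleGraph (Fin n)) (j : Fin n)
    (a : {v : Fin n // v ≠ j} → Fin 2) :
    qG G (insertAt j a 0) = qG (vertexDeleted G j) a := by
  have h : {e ∈ G.edgeSet | ∀ v ∈ e, insertAt j a 0 v = 1}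
      = {e ∈ G.edgeSet | (∀ v ∈ e, insertAt j a 0 v = 1) ∧ j ∉ e} := by
    ext e
    refine and_congr_right fun _ => ⟨fun h1 => ⟨h1, fun hj => ?_⟩, And.left⟩
    simpa [insertAt_self] using h1 j hj
  rw [qG, h, occupiedEdges_avoiding,
    Set.ncard_image_of_injective _ (Sym2.map.injective Subtype.val_injective), qG]

theorem qG_insertAt_one {n : ℕ} (G : SimpleGraph (Fin n)) (j : Fin n)
    (a : {v : Fin n // v ≠ j} → Fin 2) :
    qG G (insertAt j a 1)
      = {i : {v : Fin n // v ≠ j} | G.Adj j ↑i ∧ a i = 1}.ncard + qG (vertexDeleted G j) a := by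
  have h : {e ∈ G.edgeSet | ∀ v ∈ e, insertAt j a 1 v = 1}
      = {e ∈ G.edgeSet | (∀ v ∈ e, insertAt j a 1 v = 1) ∧ j ∈ e}
        ∪ {e ∈ G.edgeSet | (∀ v ∈ e, insertAt j a 1 v = 1) ∧ j ∉ e} := by
    ext e
    simp only [Set.mem_ofPred_eq, Set.mem_union]
    tauto
  have hinj : Function.Injective fun i : {v : Fin n // v ≠ j} => s(j, (i : Fin n)) :=
    fun _ _ h => Subtype.ext (Sym2.congr_right.1 h)
  rw [qG, h, Set.ncard_union_eq (Set.disjoint_left.2 fun _ h1 h2 => h2.2.2 h1.2.2)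
    (Set.toFinite _) (Set.toFinite _), occupiedEdges_avoiding, occupiedEdges_through,
    Set.ncard_image_of_injective _ (Sym2.map.injective Subtype.val_injective),
    Set.ncard_image_of_injective _ hinj, qG]

theorem card_eq_card_ne_add_one {n : ℕ} (j : Fin n) :
    Fintype.card (Fin n) = Fintype.card {v : Fin n // v ≠ j} + 1 := by
  have := j.pos
  simp only [ne_eq, Fintype.card_subtype_compl, Fintype.card_subtype_eq, Fintype.card_fin]
  omega

theorem graphStateVec_insertAt_zero {n : ℕ} (G : SimpleGraph (Fin n)) (j : Fin n)
    (a : {v : Fin n // v ≠ j} → Fin 2) :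
    graphStateVec G (insertAt j a 0)
      = (Real.sqrt 2 : ℂ)⁻¹ * graphStateVec (vertexDeleted G j) a := by
  rw [graphStateVec, graphStateVec, qG_insertAt_zero, card_eq_card_ne_add_one j, pow_succ,
    mul_inv]
  ring

theorem graphStateVec_insertAt_one {n : ℕ} (G : SimpleGraph (Fin n)) (j : Fin n)
    (a : {v : Fin n // v ≠ j} → Fin 2) :
    graphStateVec G (insertAt j a 1) = (Real.sqrt 2 : ℂ)⁻¹ * shrunkenVec G j a := by
  rw [shrunkenVec, graphStateVec, graphStateVec, qG_insertAt_one, card_eq_card_ne_add_one j,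
    pow_succ, pow_add, mul_inv]
  ring

/-- The partial trace of a graph state over qubit `j` is the equal mixture of
the vertex-deleted graph state and the vertex-shrunken state:
`tr_j(|G⟩⟨G|) = ½(|G_j⟩⟨G_j| + |S_j⟩⟨S_j|)`. -/
theorem ptrace_graphState {n : ℕ} (G : SimpleGraph (Fin n)) (j : Fin n) :
    ptraceQubit j (graphStateDM G)
      = (2 : ℂ)⁻¹ • (graphStateDM (vertexDeleted G j)
          + Matrix.of fun x y => shrunkenVec G j x * (starRingEnd ℂ) (shrunkenVec G j y)) := by
  have hs : (Real.sqrt 2 : ℂ)⁻¹ * (Real.sqrt 2 : ℂ)⁻¹ = 2⁻¹ := by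
    rw [← mul_inv, ← Complex.ofReal_mul, Real.mul_self_sqrt zero_le_two, Complex.ofReal_ofNat]
  ext x y
  simp only [ptraceQubit, graphStateDM, Matrix.of_apply, Fin.sum_univ_two, Matrix.smul_apply,
    Matrix.add_apply, smul_eq_mul, graphStateVec_insertAt_zero, graphStateVec_insertAt_one,
    map_mul, map_inv₀, Complex.conj_ofReal]
  rw [← hs]
  ring
end

section
/- Let G be a simple graph on Fin n and j a vertex whose neighborhood N(j) in G is nonempty. Then the vertex-deleted graph state vector |G_j⟩ and the vertex-shrunken state vector |S_j⟩ are orthogonal: ⟨G_j|S_j⟩ = 0. Consequently, the reduction tr_j(|G⟩⟨G|) = (1/2)(|G_j⟩⟨G_j| + |S_j⟩⟨S_j|) is one half of a rank-two orthogonal projector. -/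
open Finset

/-- Edges of `G` inside the support of `insertAt j a b` are those of the vertex-deleted graph,
together with the edges from `j` into the support of `a` when `b = 1`. -/
theorem qG_insertAt {n : ℕ} (G : SimpleGraph (Fin n)) (j : Fin n)
    (a : {v : Fin n // v ≠ j} → Fin 2) (b : Fin 2) :
    qG G (insertAt j a b) = qG (vertexDeleted G j) a +
      if b = 1 then {i : {v : Fin n // v ≠ j} | G.Adj j ↑i ∧ a i = 1}.ncard else 0 := by
  have hval (w : {v : Fin n // v ≠ j}) : insertAt j a b w = a w := by simp [insertAt, w.2]
  have hself : insertAt j a b j = b := by simp [insertAt]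
  set S := {e ∈ (vertexDeleted G j).edgeSet | ∀ v ∈ e, a v = 1} with hS
  set T := {i : {v : Fin n // v ≠ j} | G.Adj j ↑i ∧ a i = 1 ∧ b = 1} with hT
  have hunion : {e ∈ G.edgeSet | ∀ v ∈ e, insertAt j a b v = 1} =
      Sym2.map Subtype.val '' S ∪ (fun i : {v : Fin n // v ≠ j} => s(j, (i : Fin n))) '' T := by
    ext e
    constructor
    · rintro ⟨he, h1⟩
      induction e using Sym2.ind with
      | _ x y =>
        rw [SimpleGraph.mem_edgeSet] at he
        have hx := h1 x (by simp)
        have hy := h1 y (by simp)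
        by_cases hxj : x = j
        · subst hxj
          have hyx : y ≠ x := he.ne'
          exact Or.inr ⟨⟨y, hyx⟩, ⟨he, (hval ⟨y, hyx⟩).symm.trans hy, hself.symm.trans hx⟩, rfl⟩
        · by_cases hyj : y = j
          · subst hyj
            exact Or.inr ⟨⟨x, hxj⟩,
              ⟨he.symm, (hval ⟨x, hxj⟩).symm.trans hx, hself.symm.trans hy⟩, Sym2.eq_swap⟩
          · refine Or.inl ⟨s(⟨x, hxj⟩, ⟨y, hyj⟩), ⟨he, ?_⟩, rfl⟩
            intro v hv
            rcases Sym2.mem_iff.1 hv with rfl | rfl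
            · exact (hval _).symm.trans hx
            · exact (hval _).symm.trans hy
    · rintro (⟨f, ⟨hf, h1⟩, rfl⟩ | ⟨i, ⟨hi, h1, hb⟩, rfl⟩)
      · induction f using Sym2.ind with
        | _ x y =>
          refine ⟨hf, ?_⟩
          intro v hv
          rcases Sym2.mem_iff.1 hv with rfl | rfl
          · exact (hval _).trans (h1 _ (by simp))
          · exact (hval _).trans (h1 _ (by simp))
      · refine ⟨hi, ?_⟩
        intro v hv
        rcases Sym2.mem_iff.1 hv with rfl | rfl
        · exact hself.trans hb
        · exact (hval _).trans h1
  have hdisj : Disjoint (Sym2.map Subtype.val '' S)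
      ((fun i : {v : Fin n // v ≠ j} => s(j, (i : Fin n))) '' T) := by
    rw [Set.disjoint_left]
    rintro _ ⟨f, -, rfl⟩ ⟨i, -, hi⟩
    have hj : j ∈ Sym2.map Subtype.val f := hi ▸ Sym2.mem_mk_left j _
    obtain ⟨w, -, hw⟩ := Sym2.mem_map.1 hj
    exact w.2 hw
  have hinj : Function.Injective (fun i : {v : Fin n // v ≠ j} => s(j, (i : Fin n))) :=
    fun x y hxy => Subtype.ext (Sym2.congr_right.1 hxy)
  rw [qG, hunion, Set.ncard_union_eq hdisj,
    Set.ncard_image_of_injective _ (Sym2.map.injective Subtype.val_injective),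
    Set.ncard_image_of_injective _ hinj, qG, ← hS]
  split_ifs with hb <;> simp [hT, hb]

theorem sum_neg_one_pow_ncard_eq_zero {V : Type*} [Fintype V] [DecidableEq V] (P : V → Prop)
    (h : ∃ i, P i) :
    ∑ x : V → Fin 2, (-1 : ℂ) ^ {i | P i ∧ x i = 1}.ncard = 0 := by
  classical
  have hprod (x : V → Fin 2) : (-1 : ℂ) ^ {i | P i ∧ x i = 1}.ncard =
      ∏ i, if P i ∧ x i = 1 then -1 else 1 := by
    rw [Finset.prod_ite, Finset.prod_const, Finset.prod_const_one, mul_one,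
      ← Set.ncard_coe_finset]
    simp
  obtain ⟨i, hi⟩ := h
  simp_rw [hprod]
  rw [← Fintype.prod_sum (fun i (b : Fin 2) => if P i ∧ b = 1 then (-1 : ℂ) else 1)]
  exact Finset.prod_eq_zero (Finset.mem_univ i) (by simp [hi])

theorem conj_graphStateVec_mul_self {V : Type} [Fintype V] (G : SimpleGraph V) (x : V → Fin 2) :
    (starRingEnd ℂ) (graphStateVec G x) * graphStateVec G x = ((2 : ℂ) ^ Fintype.card V)⁻¹ := by
  have h2 : ((Real.sqrt 2 : ℝ) : ℂ) * (Real.sqrt 2 : ℝ) = 2 := by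
    rw [← Complex.ofReal_mul, Real.mul_self_sqrt zero_le_two, Complex.ofReal_ofNat]
  simp only [graphStateVec, map_mul, map_inv₀, map_pow, Complex.conj_ofReal, map_neg, map_one]
  rw [mul_mul_mul_comm, ← mul_inv, ← mul_pow, ← mul_pow, h2]
  simp

theorem conj_mul_shrunkenVec {n : ℕ} (G : SimpleGraph (Fin n)) (j : Fin n)
    (x : {v : Fin n // v ≠ j} → Fin 2) :
    (starRingEnd ℂ) (graphStateVec (vertexDeleted G j) x) * shrunkenVec G j x =
      (-1) ^ {i : {v : Fin n // v ≠ j} | G.Adj j ↑i ∧ x i = 1}.ncard *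
        ((2 : ℂ) ^ Fintype.card {v : Fin n // v ≠ j})⁻¹ := by
  rw [shrunkenVec, mul_left_comm, conj_graphStateVec_mul_self]

theorem sum_conj_mul_shrunkenVec {n : ℕ} (G : SimpleGraph (Fin n)) (j : Fin n)
    (h : ∃ i, G.Adj j i) :
    ∑ x : {v : Fin n // v ≠ j} → Fin 2,
      (starRingEnd ℂ) (graphStateVec (vertexDeleted G j) x) * shrunkenVec G j x = 0 := by
  obtain ⟨i, hi⟩ := h
  simp_rw [conj_mul_shrunkenVec, ← Finset.sum_mul]
  rw [sum_neg_one_pow_ncard_eq_zero (fun i : {v : Fin n // v ≠ j} => G.Adj j i)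
    ⟨⟨i, hi.ne'⟩, hi⟩, zero_mul]

theorem sum_conj_graphStateVec_mul_self {V : Type} [Fintype V] [DecidableEq V]
    (G : SimpleGraph V) :
    ∑ x : V → Fin 2, (starRingEnd ℂ) (graphStateVec G x) * graphStateVec G x = 1 := by
  simp [conj_graphStateVec_mul_self]

theorem conj_shrunkenVec_mul_self {n : ℕ} (G : SimpleGraph (Fin n)) (j : Fin n)
    (x : {v : Fin n // v ≠ j} → Fin 2) :
    (starRingEnd ℂ) (shrunkenVec G j x) * shrunkenVec G j x =
      (starRingEnd ℂ) (graphStateVec (vertexDeleted G j) x) *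
        graphStateVec (vertexDeleted G j) x := by
  simp only [shrunkenVec, map_mul, map_pow, map_neg, map_one]
  rw [mul_mul_mul_comm, ← mul_pow]
  simp

/-- The matrix whose two columns are `|G_j⟩` and `|S_j⟩`. -/
noncomputable def deletedShrunkenMatrix {n : ℕ} (G : SimpleGraph (Fin n)) (j : Fin n) :
    Matrix ({v : Fin n // v ≠ j} → Fin 2) (Fin 2) ℂ :=
  Matrix.of fun x => ![graphStateVec (vertexDeleted G j) x, shrunkenVec G j x]

theorem sqrt_two_mul_graphStateVec_insertAt {n : ℕ} (G : SimpleGraph (Fin n)) (j : Fin n)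
    (x : {v : Fin n // v ≠ j} → Fin 2) (b : Fin 2) :
    (Real.sqrt 2 : ℂ) * graphStateVec G (insertAt j x b) = deletedShrunkenMatrix G j x b := by
  have h2 : ((Real.sqrt 2 : ℝ) : ℂ) ≠ 0 := by simp
  have hcard : Fintype.card (Fin n) = Fintype.card {v : Fin n // v ≠ j} + 1 := by
    have := Fin.pos j
    simp only [Fintype.card_subtype_compl, Fintype.card_unique, Fintype.card_fin]
    omega
  rw [graphStateVec, hcard, qG_insertAt, pow_succ, mul_inv]
  fin_cases b
  · simp only [deletedShrunkenMatrix, graphStateVec]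
    simp
    field_simp
  · simp only [deletedShrunkenMatrix, graphStateVec, shrunkenVec]
    simp [pow_add]
    field_simp

theorem two_smul_ptraceQubit_graphStateDM {n : ℕ} (G : SimpleGraph (Fin n)) (j : Fin n) :
    (2 : ℂ) • ptraceQubit j (graphStateDM G) =
      deletedShrunkenMatrix G j * (deletedShrunkenMatrix G j).conjTranspose := by
  have h2 : ((Real.sqrt 2 : ℝ) : ℂ) * (Real.sqrt 2 : ℝ) = 2 := by
    rw [← Complex.ofReal_mul, Real.mul_self_sqrt zero_le_two, Complex.ofReal_ofNat]
  ext x y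
  simp only [Matrix.smul_apply, ptraceQubit, graphStateDM, Matrix.of_apply, Matrix.mul_apply,
    Matrix.conjTranspose_apply, smul_eq_mul, Finset.mul_sum, RCLike.star_def,
    ← sqrt_two_mul_graphStateVec_insertAt, map_mul, Complex.conj_ofReal]
  refine Finset.sum_congr rfl fun b _ => ?_
  rw [mul_mul_mul_comm, h2]

theorem conjTranspose_mul_deletedShrunkenMatrix {n : ℕ} (G : SimpleGraph (Fin n)) (j : Fin n)
    (h : ∃ i, G.Adj j i) :
    (deletedShrunkenMatrix G j).conjTranspose * deletedShrunkenMatrix G j = 1 := by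
  have horth := sum_conj_mul_shrunkenVec G j h
  have horth' := congrArg (starRingEnd ℂ) horth
  simp only [map_sum, map_mul, Complex.conj_conj, map_zero] at horth'
  have hnorm := sum_conj_graphStateVec_mul_self (vertexDeleted G j)
  ext b c
  fin_cases b <;> fin_cases c <;>
    simp [Matrix.mul_apply, deletedShrunkenMatrix, conj_shrunkenVec_mul_self, horth, hnorm]
  simpa [mul_comm] using horth'

open scoped ComplexOrder in
theorem rank_deletedShrunkenMatrix_mul_conjTranspose {n : ℕ} (G : SimpleGraph (Fin n))
    (j : Fin n) (h : ∃ i, G.Adj j i) :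
    (deletedShrunkenMatrix G j * (deletedShrunkenMatrix G j).conjTranspose).rank = 2 := by
  rw [Matrix.rank_self_mul_conjTranspose, ← Matrix.rank_conjTranspose_mul_self,
    conjTranspose_mul_deletedShrunkenMatrix G j h, Matrix.rank_one, Fintype.card_fin]

/-- If the neighborhood of `j` in `G` is nonempty, then `⟨G_j|S_j⟩ = 0`;
consequently `2 · tr_j(|G⟩⟨G|) = |G_j⟩⟨G_j| + |S_j⟩⟨S_j|` is a rank-two
orthogonal projector, i.e. the reduction is one half of such a projector. -/
theorem deleted_shrunken_orthogonal {n : ℕ} (G : SimpleGraph (Fin n)) (j : Fin n)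
    (h : ∃ i, G.Adj j i) :
    (∑ x : {v : Fin n // v ≠ j} → Fin 2,
        (starRingEnd ℂ) (graphStateVec (vertexDeleted G j) x) * shrunkenVec G j x = 0)
    ∧ ((2 : ℂ) • ptraceQubit j (graphStateDM G)) * ((2 : ℂ) • ptraceQubit j (graphStateDM G))
        = (2 : ℂ) • ptraceQubit j (graphStateDM G)
    ∧ ((2 : ℂ) • ptraceQubit j (graphStateDM G)).IsHermitian
    ∧ ((2 : ℂ) • ptraceQubit j (graphStateDM G)).rank = 2 := by
  have hunit := conjTranspose_mul_deletedShrunkenMatrix G j h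
  refine ⟨sum_conj_mul_shrunkenVec G j h, ?_, ?_, ?_⟩ <;>
    rw [two_smul_ptraceQubit_graphStateDM]
  · rw [Matrix.mul_assoc, ← Matrix.mul_assoc (deletedShrunkenMatrix G j).conjTranspose, hunit,
      Matrix.one_mul]
  · exact Matrix.isHermitian_mul_conjTranspose_self _
  · exact rank_deletedShrunkenMatrix_mul_conjTranspose G j h
end

section
/- Let G be a simple graph on Fin n and k a vertex with at least one neighbor in G. Then the one-body reduction of the graph state density matrix onto qubit k is maximally mixed: tracing out all qubits except k from |G⟩⟨G| yields the 2×2 matrix (1/2)·I. -/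
open Finset

/-- Combine an assignment on `S` with an assignment on its complement. -/
def combineOn {n : ℕ} (S : Finset (Fin n)) (a : {v : Fin n // v ∈ S} → Fin 2)
    (b : {v : Fin n // v ∉ S} → Fin 2) : Fin n → Fin 2 :=
  fun v => if h : v ∈ S then a ⟨v, h⟩ else b ⟨v, h⟩

/-- The reduction `ρ_S` of an `n`-qubit operator onto the subset `S`,
obtained by tracing out the qubits outside `S`. -/
noncomputable def reduceTo {n : ℕ} (ρ : Matrix (Fin n → Fin 2) (Fin n → Fin 2) ℂ)
    (S : Finset (Fin n)) :
    Matrix ({v : Fin n // v ∈ S} → Fin 2) ({v : Fin n // v ∈ S} → Fin 2) ℂ :=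
  Matrix.of fun a a' => ∑ b : {v : Fin n // v ∉ S} → Fin 2,
    ρ (combineOn S a b) (combineOn S a' b)

/-- Raising vertex `k` adds one active edge for each neighbor of `k` carrying a `1`. -/
theorem qG_update_one {V : Type} [Finite V] [DecidableEq V] (G : SimpleGraph V) (k : V)
    (x : V → Fin 2) :
    qG G (Function.update x k 1) =
      qG G (Function.update x k 0) + {v | G.Adj k v ∧ x v = 1}.ncard := by
  have inj : Function.Injective (fun v => s(k, v)) := fun v w hvw =>
    Sym2.congr_right.mp hvw
  rw [qG, qG, ← Set.ncard_image_of_injective {v | G.Adj k v ∧ x v = 1} inj,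
    ← Set.ncard_union_eq _ (Set.toFinite _) (Set.toFinite _)]
  · congr 1
    ext e
    induction e using Sym2.ind with
    | _ u w =>
      by_cases hu : u = k <;> by_cases hw : w = k
      · subst hu hw
        simp
      · subst hu
        simp [hw, Ne.symm hw]
      · subst hw
        simp [hu, Ne.symm hu, G.adj_comm]
      · simp [hu, hw, Ne.symm hu, Ne.symm hw]
  · rw [Set.disjoint_left]
    rintro _ ⟨-, he⟩ ⟨v, -, rfl⟩
    simpa using he k (by simp)

theorem neg_one_pow_ncard_eq_prod {V R : Type*} [Fintype V] [CommRing R] (p : V → Prop)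
    [DecidablePred p] : (-1 : R) ^ {v | p v}.ncard = ∏ v, if p v then -1 else 1 := by
  rw [Finset.prod_ite, Finset.prod_const, Finset.prod_const_one, mul_one,
    Set.ncard_eq_toFinset_card']
  simp

theorem combineOn_singleton {n : ℕ} (k : Fin n)
    (a : {v : Fin n // v ∈ ({k} : Finset (Fin n))} → Fin 2)
    (b : {v : Fin n // v ∉ ({k} : Finset (Fin n))} → Fin 2) :
    combineOn {k} a b = Function.update (combineOn {k} 0 b) k (a ⟨k, by simp⟩) := by
  ext v
  by_cases hv : v = k
  · subst hv
    simp [combineOn]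
  · simp [combineOn, hv]

/-- The signs contributed by the neighbors of `k` cancel over all assignments off `k`. -/
theorem sum_neg_one_pow_neighbors_eq_zero {n : ℕ} (G : SimpleGraph (Fin n)) (k : Fin n)
    (h : ∃ i, G.Adj k i) :
    ∑ b : {v : Fin n // v ∉ ({k} : Finset (Fin n))} → Fin 2,
      (-1 : ℂ) ^ {v | G.Adj k v ∧ combineOn {k} 0 b v = 1}.ncard = 0 := by
  classical
  obtain ⟨i, hi⟩ := h
  have hik : i ∉ ({k} : Finset (Fin n)) := by simpa using hi.ne'
  have key (b : {v : Fin n // v ∉ ({k} : Finset (Fin n))} → Fin 2) :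
      (-1 : ℂ) ^ {v | G.Adj k v ∧ combineOn {k} 0 b v = 1}.ncard =
        ∏ v, if G.Adj k v.1 ∧ b v = 1 then -1 else 1 := by
    have hset : {v | G.Adj k v ∧ combineOn {k} 0 b v = 1} =
        Subtype.val '' {v : {v : Fin n // v ∉ ({k} : Finset (Fin n))} |
          G.Adj k v.1 ∧ b v = 1} := by
      ext v
      by_cases hv : v = k
      · subst hv
        simp
      · simp [combineOn, hv]
    rw [hset, Set.ncard_image_of_injective _ Subtype.val_injective, neg_one_pow_ncard_eq_prod]
  simp_rw [key]
  rw [← Fintype.prod_sum (fun (v : {v : Fin n // v ∉ ({k} : Finset (Fin n))}) (c : Fin 2) =>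
    if G.Adj k v.1 ∧ c = 1 then (-1 : ℂ) else 1)]
  exact Finset.prod_eq_zero (Finset.mem_univ ⟨i, hik⟩) (by simp [hi])

theorem graphStateDM_apply {V : Type} [Fintype V] (G : SimpleGraph V) (x y : V → Fin 2) :
    graphStateDM G x y = ((2 : ℂ) ^ Fintype.card V)⁻¹ * ((-1) ^ qG G x * (-1) ^ qG G y) := by
  have h2 : (Real.sqrt 2 : ℂ) * Real.sqrt 2 = 2 := by
    rw [← Complex.ofReal_mul, Real.mul_self_sqrt (by norm_num)]
    norm_num
  simp only [graphStateDM, graphStateVec, Matrix.of_apply, map_mul, map_inv₀, map_pow,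
    Complex.conj_ofReal, map_neg, map_one]
  rw [← h2, mul_pow, mul_inv]
  ring

/-- If vertex `k` has at least one neighbor in `G`, the one-body reduction of
the graph state `|G⟩⟨G|` onto qubit `k` is maximally mixed: it equals `½·I`. -/
theorem graphState_one_body_maximally_mixed {n : ℕ} (G : SimpleGraph (Fin n)) (k : Fin n)
    (h : ∃ i, G.Adj k i) :
    reduceTo (graphStateDM G) {k} = (2 : ℂ)⁻¹ • (1 : Matrix _ _ ℂ) := by
  ext a a'
  simp only [reduceTo, Matrix.of_apply, graphStateDM_apply, Matrix.smul_apply, smul_eq_mul,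
    ← Finset.mul_sum, Fintype.card_fin]
  have ext_at {c c' : {v : Fin n // v ∈ ({k} : Finset (Fin n))} → Fin 2}
      (hc : c ⟨k, by simp⟩ = c' ⟨k, by simp⟩) : c = c' := by
    ext ⟨v, hv⟩
    obtain rfl := Finset.mem_singleton.mp hv
    rw [hc]
  by_cases haa : a = a'
  · subst haa
    obtain ⟨m, rfl⟩ := Nat.exists_eq_succ_of_ne_zero (Fin.pos k).ne'
    simp [← mul_pow, pow_succ]
  · rw [Matrix.one_apply_ne haa, mul_zero]
    have hne : a ⟨k, by simp⟩ ≠ a' ⟨k, by simp⟩ := fun he => haa (ext_at he)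
    have sign (b : {v : Fin n // v ∉ ({k} : Finset (Fin n))} → Fin 2) :
        (-1 : ℂ) ^ qG G (combineOn {k} a b) * (-1) ^ qG G (combineOn {k} a' b) =
          (-1) ^ {v | G.Adj k v ∧ combineOn {k} 0 b v = 1}.ncard := by
      rw [combineOn_singleton k a, combineOn_singleton k a']
      generalize a ⟨k, by simp⟩ = s at hne ⊢
      generalize a' ⟨k, by simp⟩ = t at hne ⊢
      have hst : s = 0 ∧ t = 1 ∨ s = 1 ∧ t = 0 := by omega
      obtain ⟨rfl, rfl⟩ | ⟨rfl, rfl⟩ := hst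
      · rw [qG_update_one, pow_add, ← mul_assoc, ← mul_pow]
        simp
      · rw [qG_update_one, pow_add, mul_right_comm, ← mul_pow]
        simp
    simp_rw [sign]
    rw [sum_neg_one_pow_neighbors_eq_zero G k h, mul_zero]
end

section
/- A graph state is determined among graph states by a single card of its (n−1)-deck: let G and H be simple graphs on Fin n and let j be a vertex whose neighborhood in G is nonempty. If the partial traces over qubit j of the two graph state density matrices coincide, tr_j(|G⟩⟨G|) = tr_j(|H⟩⟨H|), then G = H. -/
open Finset

/-- The number of edges of `G` with both endpoints in `S`. -/
noncomputable def edgesWithin {V : Type} (G : SimpleGraph V) (S : Set V) : ℕ :=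
  {e ∈ G.edgeSet | ∀ v ∈ e, v ∈ S}.ncard

lemma edgesWithin_subsingleton {V : Type} (G : SimpleGraph V) {S : Set V}
    (hS : S.Subsingleton) : edgesWithin G S = 0 := by
  have h : {e ∈ G.edgeSet | ∀ v ∈ e, v ∈ S} = ∅ := by
    ext e
    induction e with
    | _ a b =>
      simp only [Set.mem_ofPred_eq, SimpleGraph.mem_edgeSet, Sym2.mem_iff, forall_eq_or_imp,
        forall_eq, Set.mem_empty_iff_false, iff_false, not_and]
      exact fun hab ha hb => hab.ne (hS ha hb)
  rw [edgesWithin, h, Set.ncard_empty]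

open Classical in
lemma edgesWithin_triple {V : Type} (G : SimpleGraph V) {u v w : V}
    (huv : u ≠ v) (huw : u ≠ w) (hvw : v ≠ w) :
    edgesWithin G {u, v, w} = (if G.Adj u v then 1 else 0) + (if G.Adj u w then 1 else 0) +
      (if G.Adj v w then 1 else 0) := by
  have h : {e ∈ G.edgeSet | ∀ z ∈ e, z ∈ ({u, v, w} : Set V)} =
      (({s(u, v), s(u, w), s(v, w)} : Finset (Sym2 V)).filter (· ∈ G.edgeSet) :
        Finset (Sym2 V)) := by
    ext e
    induction e with
    | _ a b =>
      simp only [Set.mem_ofPred_eq, SimpleGraph.mem_edgeSet, Sym2.mem_iff, forall_eq_or_imp,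
        forall_eq, Set.mem_insert_iff, Set.mem_singleton_iff, coe_filter, Finset.mem_insert,
        Finset.mem_singleton, Sym2.eq_iff]
      have := G.ne_of_adj (a := a) (b := b)
      grind
  rw [edgesWithin, h, Set.ncard_coe_finset, Finset.card_filter, Finset.sum_insert (by grind),
    Finset.sum_insert (by grind), Finset.sum_singleton, ← add_assoc]
  simp only [SimpleGraph.mem_edgeSet]

open Classical in
lemma edgesWithin_pair {V : Type} (G : SimpleGraph V) {u v : V} :
    edgesWithin G {u, v} = if G.Adj u v then 1 else 0 := by
  have h : {e ∈ G.edgeSet | ∀ z ∈ e, z ∈ ({u, v} : Set V)} =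
      (({s(u, v)} : Finset (Sym2 V)).filter (· ∈ G.edgeSet) : Finset (Sym2 V)) := by
    ext e
    induction e with
    | _ a b =>
      simp only [Set.mem_ofPred_eq, SimpleGraph.mem_edgeSet, Sym2.mem_iff, forall_eq_or_imp,
        forall_eq, Set.mem_insert_iff, Set.mem_singleton_iff, coe_filter,
        Finset.mem_singleton, Sym2.eq_iff]
      have := G.ne_of_adj (a := a) (b := b)
      grind
  rw [edgesWithin, h, Set.ncard_coe_finset, Finset.card_filter, Finset.sum_singleton]
  simp only [SimpleGraph.mem_edgeSet]

open Classical in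
/-- The assignment on the vertices other than `j` that is `1` exactly on `S`. -/
noncomputable def indicatorOff {n : ℕ} (j : Fin n) (S : Set (Fin n)) :
    {v : Fin n // v ≠ j} → Fin 2 :=
  fun v => if v.1 ∈ S then 1 else 0

lemma qG_insertAt_indicatorOff_zero {n : ℕ} (G : SimpleGraph (Fin n)) {j : Fin n}
    {S : Set (Fin n)} (hj : j ∉ S) :
    qG G (insertAt j (indicatorOff j S) 0) = edgesWithin G S := by
  have h (v : Fin n) : insertAt j (indicatorOff j S) 0 v = 1 ↔ v ∈ S := by
    unfold insertAt indicatorOff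
    split_ifs <;> simp_all
  simp only [qG, edgesWithin, h]

lemma qG_insertAt_indicatorOff_one {n : ℕ} (G : SimpleGraph (Fin n)) (j : Fin n)
    (S : Set (Fin n)) :
    qG G (insertAt j (indicatorOff j S) 1) = edgesWithin G (insert j S) := by
  have h (v : Fin n) : insertAt j (indicatorOff j S) 1 v = 1 ↔ v ∈ insert j S := by
    unfold insertAt indicatorOff
    split_ifs <;> simp_all
  simp only [qG, edgesWithin, h]

lemma ptraceQubit_graphStateDM_apply {n : ℕ} (G : SimpleGraph (Fin n)) {j : Fin n}
    {S T : Set (Fin n)} (hS : j ∉ S) (hT : j ∉ T) :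
    ptraceQubit j (graphStateDM G) (indicatorOff j S) (indicatorOff j T) =
      (((Real.sqrt 2 : ℂ) ^ n)⁻¹) ^ 2 *
        ((-1) ^ edgesWithin G S * (-1) ^ edgesWithin G T +
          (-1) ^ edgesWithin G (insert j S) * (-1) ^ edgesWithin G (insert j T)) := by
  simp only [ptraceQubit, graphStateDM, graphStateVec, Matrix.of_apply, Fin.sum_univ_two,
    qG_insertAt_indicatorOff_zero G hS, qG_insertAt_indicatorOff_zero G hT,
    qG_insertAt_indicatorOff_one, Fintype.card_fin, map_mul, map_inv₀, map_pow, map_neg, map_one,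
    Complex.conj_ofReal]
  ring

lemma edgesWithin_signs_eq {n : ℕ} {G H : SimpleGraph (Fin n)} {j : Fin n}
    (heq : ptraceQubit j (graphStateDM G) = ptraceQubit j (graphStateDM H))
    {S T : Set (Fin n)} (hS : j ∉ S) (hT : j ∉ T) :
    ((-1) ^ edgesWithin G S * (-1) ^ edgesWithin G T +
        (-1) ^ edgesWithin G (insert j S) * (-1) ^ edgesWithin G (insert j T) : ℂ) =
      (-1) ^ edgesWithin H S * (-1) ^ edgesWithin H T +
        (-1) ^ edgesWithin H (insert j S) * (-1) ^ edgesWithin H (insert j T) := by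
  have h := congrFun (congrFun heq (indicatorOff j S)) (indicatorOff j T)
  rw [ptraceQubit_graphStateDM_apply G hS hT, ptraceQubit_graphStateDM_apply H hS hT] at h
  exact mul_left_cancel₀ (by simp) h

lemma adj_iff_of_ptraceQubit_eq {n : ℕ} {G H : SimpleGraph (Fin n)} {j : Fin n}
    (heq : ptraceQubit j (graphStateDM G) = ptraceQubit j (graphStateDM H)) (i : Fin n) :
    G.Adj j i ↔ H.Adj j i := by
  rcases eq_or_ne j i with rfl | hi
  · simp
  have h := edgesWithin_signs_eq heq (S := {i}) (T := ∅) (by simpa using hi) (by simp)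
  simp only [edgesWithin_pair, insert_empty_eq,
    edgesWithin_subsingleton _ Set.subsingleton_singleton,
    edgesWithin_subsingleton _ Set.subsingleton_empty] at h
  split_ifs at h <;> first | tauto | norm_num at h

lemma adj_iff_of_ptraceQubit_eq_of_not_adj {n : ℕ} {G H : SimpleGraph (Fin n)} {j u v : Fin n}
    (heq : ptraceQubit j (graphStateDM G) = ptraceQubit j (graphStateDM H))
    (hu : j ≠ u) (hv : j ≠ v) (huv : u ≠ v) (hjv : ¬ G.Adj j v) :
    G.Adj u v ↔ H.Adj u v := by
  have h := edgesWithin_signs_eq heq (S := {u, v}) (T := {u}) (by simp [hu, hv]) (by simpa using hu)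
  have hjv' := (adj_iff_of_ptraceQubit_eq heq v).not.mp hjv
  simp only [edgesWithin_pair, edgesWithin_triple _ hu hv huv, hjv, hjv',
    adj_iff_of_ptraceQubit_eq heq u, edgesWithin_subsingleton _ Set.subsingleton_singleton] at h
  split_ifs at h <;> first | tauto | norm_num at h

lemma adj_iff_of_ptraceQubit_eq_of_adj {n : ℕ} {G H : SimpleGraph (Fin n)} {j u v : Fin n}
    (heq : ptraceQubit j (graphStateDM G) = ptraceQubit j (graphStateDM H))
    (huv : u ≠ v) (hju : G.Adj j u) (hjv : G.Adj j v) :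
    G.Adj u v ↔ H.Adj u v := by
  have h := edgesWithin_signs_eq heq (S := {u, v}) (T := ∅) (by simp [hju.ne, hjv.ne]) (by simp)
  have hju' := (adj_iff_of_ptraceQubit_eq heq u).mp hju
  have hjv' := (adj_iff_of_ptraceQubit_eq heq v).mp hjv
  simp only [edgesWithin_pair, edgesWithin_triple _ hju.ne hjv.ne huv, hju, hjv, hju', hjv',
    insert_empty_eq, edgesWithin_subsingleton _ Set.subsingleton_singleton,
    edgesWithin_subsingleton _ Set.subsingleton_empty] at h
  split_ifs at h <;> first | tauto | norm_num at h

/-- A graph state is determined among graph states by a single card of its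
`(n-1)`-deck: if the neighborhood of `j` in `G` is nonempty and the partial
traces over qubit `j` of `|G⟩⟨G|` and `|H⟩⟨H|` coincide, then `G = H`. -/
theorem graphState_determined_by_one_card {n : ℕ} (G H : SimpleGraph (Fin n)) (j : Fin n)
    (h : ∃ i, G.Adj j i)
    (heq : ptraceQubit j (graphStateDM G) = ptraceQubit j (graphStateDM H)) :
    G = H := by
  ext u v
  rcases eq_or_ne u v with rfl | huv
  · simp
  rcases eq_or_ne j u with rfl | hu
  · exact adj_iff_of_ptraceQubit_eq heq v
  rcases eq_or_ne j v with rfl | hv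
  · rw [G.adj_comm, H.adj_comm, adj_iff_of_ptraceQubit_eq heq u]
  by_cases hjv : G.Adj j v
  · by_cases hju : G.Adj j u
    · exact adj_iff_of_ptraceQubit_eq_of_adj heq huv hju hjv
    · rw [G.adj_comm, H.adj_comm]
      exact adj_iff_of_ptraceQubit_eq_of_not_adj heq hv hu huv.symm hju
  · exact adj_iff_of_ptraceQubit_eq_of_not_adj heq hu hv huv hjv
end

section
/- (Type I / type II dichotomy.) Let G be a simple graph on Fin n and let A_j denote the weight distribution of its graph state density matrix ρ_G = |G⟩⟨G|. Then the sum of the even weights takes one of exactly two values: ∑_{j even, 0 ≤ j ≤ n} A_j(ρ_G) = 2^{n−1} or ∑_{j even, 0 ≤ j ≤ n} A_j(ρ_G) = 2^n. -/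
open Finset

/-- The single-qubit Pauli matrices `σ₀ = I`, `σ₁ = X`, `σ₂ = Y`, `σ₃ = Z`. -/
noncomputable def pauli : Fin 4 → Matrix (Fin 2) (Fin 2) ℂ :=
  ![!![1, 0; 0, 1], !![0, 1; 1, 0], !![0, -Complex.I; Complex.I, 0], !![1, 0; 0, -1]]

/-- The `n`-qubit Pauli operator `P_f` with entries `P_f(x,y) = ∏ i, σ_{f i}(x i, y i)`. -/
noncomputable def pauliOp {ι : Type} [Fintype ι] (f : ι → Fin 4) :
    Matrix (ι → Fin 2) (ι → Fin 2) ℂ :=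
  Matrix.of fun x y => ∏ i, pauli (f i) (x i) (y i)

/-- The weight of a Pauli label: the number of qubits on which it acts non-trivially. -/
def pauliWt {ι : Type} [Fintype ι] [DecidableEq ι] (f : ι → Fin 4) : ℕ :=
  (Finset.univ.filter fun i => f i ≠ 0).card

/-- The weight distribution `A_j(ρ) = ∑_{f : wt(f) = j} tr(P_f ρ) · tr(P_f ρ)`. -/
noncomputable def weightA {ι : Type} [Fintype ι] [DecidableEq ι]
    (ρ : Matrix (ι → Fin 2) (ι → Fin 2) ℂ) (j : ℕ) : ℂ :=
  ∑ f ∈ Finset.univ.filter (fun f : ι → Fin 4 => pauliWt f = j),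
    (pauliOp f * ρ).trace * (pauliOp f * ρ).trace

section WeightedPauliSums

variable {ι : Type} [Fintype ι]

theorem prod_ite_eq_and_eq (z w x y : ι → Fin 2) (g : ι → ℂ) :
    (∏ i, if z i = x i ∧ w i = y i then g i else 0) =
      if w = y then if z = x then ∏ i, g i else 0 else 0 := by
  split_ifs with hw hz
  · simp [hz, hw]
  · obtain ⟨i, hi⟩ := Function.ne_iff.1 hz
    exact Finset.prod_eq_zero (mem_univ i) (by simp [hi])
  · obtain ⟨i, hi⟩ := Function.ne_iff.1 hw
    exact Finset.prod_eq_zero (mem_univ i) (by simp [hi])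

variable [DecidableEq ι]

/-- Expansion of a weighted sum of squared Pauli expectations as a sum of products over qubits. -/
theorem sum_prod_mul_trace_pauliOp_sq (ρ : Matrix (ι → Fin 2) (ι → Fin 2) ℂ) (ε : Fin 4 → ℂ) :
    ∑ f : ι → Fin 4, (∏ i, ε (f i)) * ((pauliOp f * ρ).trace * (pauliOp f * ρ).trace) =
      ∑ x : ι → Fin 2, ∑ y : ι → Fin 2, ∑ z : ι → Fin 2, ∑ w : ι → Fin 2,
        (∏ i, ∑ k, ε k * (pauli k (x i) (y i) * pauli k (z i) (w i))) * (ρ y x * ρ w z) := by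
  have h (x y z w : ι → Fin 2) :
      (∏ i, ∑ k, ε k * (pauli k (x i) (y i) * pauli k (z i) (w i))) * (ρ y x * ρ w z) =
        ∑ f : ι → Fin 4, (∏ i, ε (f i)) * ((pauliOp f x y * ρ y x) * (pauliOp f z w * ρ w z)) := by
    rw [Finset.prod_univ_sum, Fintype.piFinset_univ, Finset.sum_mul]
    refine Finset.sum_congr rfl fun f _ => ?_
    simp only [pauliOp, Matrix.of_apply, Finset.prod_mul_distrib]
    ring
  have ht (f : ι → Fin 4) : (∏ i, ε (f i)) * ((pauliOp f * ρ).trace * (pauliOp f * ρ).trace) =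
      ∑ x : ι → Fin 2, ∑ y : ι → Fin 2, ∑ z : ι → Fin 2, ∑ w : ι → Fin 2,
        (∏ i, ε (f i)) * ((pauliOp f x y * ρ y x) * (pauliOp f z w * ρ w z)) := by
    simp only [Matrix.trace, Matrix.diag, Matrix.mul_apply, ← Finset.mul_sum, ← Finset.sum_mul]
  simp only [h, ht]
  rw [Finset.sum_comm]
  refine Finset.sum_congr rfl fun x _ => ?_
  rw [Finset.sum_comm]
  refine Finset.sum_congr rfl fun y _ => ?_
  rw [Finset.sum_comm]
  refine Finset.sum_congr rfl fun z _ => ?_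
  rw [Finset.sum_comm]

theorem sum_pauli_mul_pauli (a b c d : Fin 2) :
    ∑ k, (1 : ℂ) * (pauli k a b * pauli k c d) = if c = b ∧ d = a then 2 else 0 := by
  fin_cases a <;> fin_cases b <;> fin_cases c <;> fin_cases d <;>
    simp [pauli, Fin.sum_univ_four] <;> norm_num

theorem sum_signed_pauli_mul_pauli (a b c d : Fin 2) :
    ∑ k, (if k ≠ 0 then (-1 : ℂ) else 1) * (pauli k a b * pauli k c d) =
      if c = 1 - a ∧ d = 1 - b then 2 * ((-1) ^ (a : ℕ) * (-1) ^ (b : ℕ)) else 0 := by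
  fin_cases a <;> fin_cases b <;> fin_cases c <;> fin_cases d <;>
    simp [pauli, Fin.sum_univ_four] <;> norm_num

theorem sum_trace_pauliOp_sq (ρ : Matrix (ι → Fin 2) (ι → Fin 2) ℂ) :
    ∑ f : ι → Fin 4, (pauliOp f * ρ).trace * (pauliOp f * ρ).trace =
      2 ^ Fintype.card ι * ∑ x, ∑ y, ρ y x * ρ x y := by
  have h := sum_prod_mul_trace_pauliOp_sq ρ fun _ => 1
  simp only [sum_pauli_mul_pauli, prod_ite_eq_and_eq] at h
  simpa [ite_mul, Finset.mul_sum] using h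

theorem sum_neg_one_pow_pauliWt_mul_trace_sq (ρ : Matrix (ι → Fin 2) (ι → Fin 2) ℂ) :
    ∑ f : ι → Fin 4, (-1) ^ pauliWt f * ((pauliOp f * ρ).trace * (pauliOp f * ρ).trace) =
      2 ^ Fintype.card ι * ∑ x : ι → Fin 2, ∑ y : ι → Fin 2,
        ((∏ i, (-1) ^ (x i : ℕ)) * ∏ i, (-1) ^ (y i : ℕ)) *
          (ρ y x * ρ (fun i => 1 - y i) (fun i => 1 - x i)) := by
  have h := sum_prod_mul_trace_pauliOp_sq ρ fun k => if k ≠ 0 then -1 else 1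
  simp only [sum_signed_pauli_mul_pauli] at h
  have hp (x y z w : ι → Fin 2) := prod_ite_eq_and_eq z w (fun i => 1 - x i) (fun i => 1 - y i)
    fun i => 2 * ((-1) ^ (x i : ℕ) * (-1) ^ (y i : ℕ))
  simp only [hp, ite_mul, zero_mul, Finset.sum_ite_eq', mem_univ, if_true,
    Finset.prod_mul_distrib, Finset.prod_const, Finset.card_univ] at h
  have hw (f : ι → Fin 4) : ∏ i, (if f i ≠ 0 then (-1 : ℂ) else 1) = (-1) ^ pauliWt f := by
    rw [← Finset.prod_filter, Finset.prod_const, pauliWt]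
  simp only [hw] at h
  rw [h]
  simp only [Finset.mul_sum, mul_assoc]

theorem sum_even_weightA (ρ : Matrix (ι → Fin 2) (ι → Fin 2) ℂ) :
    ∑ j ∈ (range (Fintype.card ι + 1)).filter (fun j => Even j), weightA ρ j =
      ((∑ f : ι → Fin 4, (pauliOp f * ρ).trace * (pauliOp f * ρ).trace) +
        ∑ f : ι → Fin 4, (-1) ^ pauliWt f * ((pauliOp f * ρ).trace * (pauliOp f * ρ).trace)) / 2 := by
  simp only [weightA, Finset.sum_filter]
  have hf (f : ι → Fin 4) (t : ℂ) :
      (∑ j ∈ range (Fintype.card ι + 1), if Even j then if pauliWt f = j then t else 0 else 0) =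
        (t + (-1) ^ pauliWt f * t) / 2 := by
    have hle : pauliWt f < Fintype.card ι + 1 := Nat.lt_succ_of_le (Finset.card_le_univ _)
    rw [Finset.sum_eq_single_of_mem (pauliWt f) (mem_range.2 hle)
      fun j _ hj => by simp [hj.symm]]
    rcases Nat.even_or_odd (pauliWt f) with he | ho
    · simp [he]
    · simp [ho.neg_one_pow, Nat.not_even_iff_odd.2 ho]
  rw [← Finset.sum_add_distrib, Finset.sum_div]
  simp only [← hf]
  rw [Finset.sum_comm]
  refine Finset.sum_congr rfl fun j _ => ?_
  split_ifs <;> simp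

end WeightedPauliSums

section GraphStates

variable {V : Type} [Fintype V] (G : SimpleGraph V)

theorem graphStateDM_mul_graphStateDM (x y z w : V → Fin 2) :
    graphStateDM G y x * graphStateDM G w z =
      ((2 : ℂ) ^ Fintype.card V * 2 ^ Fintype.card V)⁻¹ *
        (((-1) ^ qG G x * (-1) ^ qG G z) * ((-1) ^ qG G y * (-1) ^ qG G w)) := by
  have h2 : (2 : ℂ) = (Real.sqrt 2 : ℂ) * (Real.sqrt 2 : ℂ) := by
    rw [← Complex.ofReal_mul, Real.mul_self_sqrt (by norm_num)]
    simp
  simp only [graphStateDM, graphStateVec, Matrix.of_apply, map_mul, map_inv₀, map_pow, map_neg,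
    map_one, Complex.conj_ofReal]
  rw [h2]
  simp only [mul_pow, mul_inv]
  ring

variable [DecidableEq V]

theorem sum_trace_pauliOp_graphStateDM_sq :
    ∑ f : V → Fin 4, (pauliOp f * graphStateDM G).trace * (pauliOp f * graphStateDM G).trace =
      2 ^ Fintype.card V := by
  have h (x : V → Fin 2) : (-1 : ℂ) ^ qG G x * (-1) ^ qG G x = 1 := by
    rw [← mul_pow]; simp
  have h' (x y : V → Fin 2) : ((-1 : ℂ) ^ qG G x * (-1) ^ qG G y) *
      ((-1) ^ qG G y * (-1) ^ qG G x) = 1 := by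
    rw [mul_mul_mul_comm, mul_comm ((-1 : ℂ) ^ qG G y), mul_mul_mul_comm, h, h, mul_one]
  rw [sum_trace_pauliOp_sq]
  simp [graphStateDM_mul_graphStateDM, h']

variable [DecidableRel G.Adj]

theorem neg_one_pow_qG (x : V → Fin 2) :
    (-1 : ℂ) ^ qG G x = ∏ e ∈ G.edgeFinset, if ∀ v ∈ e, x v = 1 then -1 else 1 := by
  classical
  rw [← Finset.prod_filter, Finset.prod_const, qG, ← Set.ncard_coe_finset]
  congr 2
  ext e
  simp

theorem prod_edgeFinset_prod_mem (z : V → ℂ) :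
    ∏ e ∈ G.edgeFinset, ∏ v with v ∈ e, z v = ∏ v, z v ^ G.degree v := by
  rw [Finset.prod_comm' (t' := univ) (s' := fun v => G.incidenceFinset v)]
  · simp
  · intro e v
    simp [SimpleGraph.incidenceFinset_eq_filter]

/-- Modulo two, the edges inside a vertex set and inside its complement are counted by the
total number of edges and the degrees of the vertices in the set. -/
theorem neg_one_pow_qG_mul_compl (x : V → Fin 2) :
    (-1 : ℂ) ^ qG G x * (-1) ^ qG G (fun v => 1 - x v) =
      (-1) ^ #G.edgeFinset * ∏ v, ((-1) ^ (x v : ℕ)) ^ G.degree v := by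
  rw [neg_one_pow_qG, neg_one_pow_qG, ← prod_edgeFinset_prod_mem, ← Finset.prod_const,
    ← Finset.prod_mul_distrib, ← Finset.prod_mul_distrib]
  refine Finset.prod_congr rfl fun e he => ?_
  induction e with | _ u v => ?_
  have huv : u ≠ v := (SimpleGraph.mem_edgeFinset.1 he : G.Adj u v).ne
  have hfilter : (univ.filter fun w => w ∈ s(u, v)) = {u, v} := by ext; simp
  rw [hfilter, Finset.prod_pair huv]
  simp only [Sym2.mem_iff, forall_eq_or_imp, forall_eq]
  generalize x u = a
  generalize x v = b
  fin_cases a <;> fin_cases b <;> simp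

theorem sum_prod_neg_one_pow_pow_degree :
    ∑ x : V → Fin 2, (∏ v, (-1 : ℂ) ^ (x v : ℕ)) * ∏ v, ((-1) ^ (x v : ℕ)) ^ G.degree v =
      if ∀ v, Odd (G.degree v) then 2 ^ Fintype.card V else 0 := by
  have h : ∑ x : V → Fin 2, (∏ v, (-1 : ℂ) ^ (x v : ℕ)) * ∏ v, ((-1) ^ (x v : ℕ)) ^ G.degree v =
      ∏ v, ∑ a : Fin 2, (-1 : ℂ) ^ (a : ℕ) * ((-1) ^ (a : ℕ)) ^ G.degree v := by
    rw [Finset.prod_univ_sum, Fintype.piFinset_univ]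
    simp only [Finset.prod_mul_distrib]
  rw [h]
  split_ifs with hodd
  · rw [← Finset.card_univ, ← Finset.prod_const]
    refine Finset.prod_congr rfl fun v _ => ?_
    simp [(hodd v).neg_one_pow]
    norm_num
  · push Not at hodd
    obtain ⟨v, hv⟩ := hodd
    exact Finset.prod_eq_zero (mem_univ v) (by simp [(Nat.not_odd_iff_even.1 hv).neg_one_pow])

theorem sum_neg_one_pow_pauliWt_mul_trace_graphStateDM_sq :
    ∑ f : V → Fin 4, (-1) ^ pauliWt f *
        ((pauliOp f * graphStateDM G).trace * (pauliOp f * graphStateDM G).trace) =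
      if ∀ v, Odd (G.degree v) then 2 ^ Fintype.card V else 0 := by
  have hs : ((-1 : ℂ) ^ #G.edgeFinset) * (-1) ^ #G.edgeFinset = 1 := by
    rw [← mul_pow]; simp
  have h (x y : V → Fin 2) :
      ((∏ v, (-1 : ℂ) ^ (x v : ℕ)) * ∏ v, (-1 : ℂ) ^ (y v : ℕ)) *
          (graphStateDM G y x * graphStateDM G (fun v => 1 - y v) (fun v => 1 - x v)) =
        ((2 : ℂ) ^ Fintype.card V * 2 ^ Fintype.card V)⁻¹ *
          (((∏ v, (-1 : ℂ) ^ (x v : ℕ)) * ∏ v, ((-1) ^ (x v : ℕ)) ^ G.degree v) *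
            ((∏ v, (-1 : ℂ) ^ (y v : ℕ)) * ∏ v, ((-1) ^ (y v : ℕ)) ^ G.degree v)) := by
    rw [graphStateDM_mul_graphStateDM, neg_one_pow_qG_mul_compl, neg_one_pow_qG_mul_compl,
      mul_mul_mul_comm ((-1 : ℂ) ^ #G.edgeFinset), hs]
    ring
  rw [sum_neg_one_pow_pauliWt_mul_trace_sq]
  simp only [h]
  simp only [← Finset.mul_sum, ← Finset.sum_mul, sum_prod_neg_one_pow_pow_degree]
  split_ifs
  · field_simp
  · simp

end GraphStates

/-- Type I / type II dichotomy: for any graph state on `n` qubits, the sum of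
the even-weight contributions of its weight distribution equals either
`2^(n-1)` or `2^n`. -/
theorem graphState_type_dichotomy {n : ℕ} (G : SimpleGraph (Fin n)) :
    (∑ j ∈ (Finset.range (n + 1)).filter (fun j => Even j), weightA (graphStateDM G) j)
        = (2 : ℂ) ^ (n - 1)
    ∨ (∑ j ∈ (Finset.range (n + 1)).filter (fun j => Even j), weightA (graphStateDM G) j)
        = (2 : ℂ) ^ n := by
  classical
  have h := sum_even_weightA (graphStateDM G)
  rw [sum_trace_pauliOp_graphStateDM_sq, sum_neg_one_pow_pauliWt_mul_trace_graphStateDM_sq,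
    Fintype.card_fin] at h
  rw [h]
  split_ifs with hodd
  · right
    ring
  · left
    obtain ⟨v, -⟩ := not_forall.1 hodd
    obtain ⟨m, rfl⟩ : ∃ m, n = m + 1 := Nat.exists_eq_succ_of_ne_zero v.pos.ne'
    simp [pow_succ]
end

section
/- The weight distribution of a graph state counts its stabilizer elements by weight, and is given combinatorially by: for every simple graph G on Fin n and every 0 ≤ j ≤ n, A_j(|G⟩⟨G|) equals the number of subsets I ⊆ Fin n such that #{v ∈ Fin n : v ∈ I or |N(v) ∩ I| is odd} = j, where N(v) is the neighborhood of v in G. -/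
open Finset

/-- The residue modulo 2 of a bit. -/
def bitCast (s : Fin 2) : ZMod 2 := (s.val : ZMod 2)

/-- The bit flipped by a Pauli matrix: `1` for `X` and `Y`. -/
def pauliX : Fin 4 → Fin 2 := ![0, 1, 1, 0]

/-- The phase bit of a Pauli matrix: `1` for `Y` and `Z`. -/
def pauliZ : Fin 4 → ZMod 2 := ![0, 0, 1, 1]

/-- The scalar relating a Pauli matrix to `Z ^ pauliZ * X ^ pauliX`. -/
noncomputable def pauliPhase : Fin 4 → ℂ := ![1, 1, -Complex.I, 1]

/-- The sign character `z ↦ (-1) ^ z` of `ZMod 2`. -/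
noncomputable def signChar : AddChar (ZMod 2) ℂ :=
  AddChar.zmodChar 2 (ζ := (-1 : ℂ)) (by norm_num)

theorem bitCast_add (s t : Fin 2) : bitCast (s + t) = bitCast s + bitCast t := by
  revert s t; decide

theorem signChar_natCast (k : ℕ) : signChar (k : ZMod 2) = (-1) ^ k :=
  AddChar.zmodChar_apply' _ k

theorem signChar_one : signChar 1 = -1 := by
  simpa using signChar_natCast 1

theorem signChar_sum {ι : Type*} (s : Finset ι) (g : ι → ZMod 2) :
    signChar (∑ i ∈ s, g i) = ∏ i ∈ s, signChar (g i) :=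
  map_prod signChar.toMonoidHom (fun i => Multiplicative.ofAdd (g i)) s

theorem signChar_mul_self (z : ZMod 2) : signChar z * signChar z = 1 := by
  rw [← AddChar.map_add_eq_mul, CharTwo.add_self_eq_zero, AddChar.map_zero_eq_one]

theorem pauli_apply (k : Fin 4) (s t : Fin 2) :
    pauli k s t =
      if t = s + pauliX k then pauliPhase k * signChar (bitCast s * pauliZ k) else 0 := by
  fin_cases k <;> fin_cases s <;> fin_cases t <;>
    simp [pauli, pauliX, pauliZ, pauliPhase, bitCast, signChar_one]

theorem pauliPhase_mul_self (k : Fin 4) :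
    pauliPhase k * pauliPhase k = signChar (bitCast (pauliX k) * pauliZ k) := by
  fin_cases k <;> simp [pauliX, pauliZ, pauliPhase, bitCast, signChar_one]

theorem sum_signChar_bitCast_mul (z : ZMod 2) :
    ∑ s : Fin 2, signChar (bitCast s * z) = if z = 0 then 2 else 0 := by
  rw [Fin.sum_univ_two]
  obtain rfl | rfl : z = 0 ∨ z = 1 := by revert z; decide
  · norm_num [bitCast]
  · simp [bitCast, signChar_one]

section GraphForms

variable {n : ℕ} (G : SimpleGraph (Fin n)) [DecidableRel G.Adj]

/-- The quadratic form `∑ x v * x w` over the edges of `G`. -/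
def edgeForm (x : Fin n → ZMod 2) : ZMod 2 :=
  ∑ v, ∑ w, if G.Adj v w ∧ v < w then x v * x w else 0

/-- The sum of `a` over the neighbours of `v`. -/
def nbrSum (a : Fin n → ZMod 2) (v : Fin n) : ZMod 2 :=
  ∑ w, if G.Adj v w then a w else 0

theorem edgeForm_add (x a : Fin n → ZMod 2) :
    edgeForm G (fun v => x v + a v)
      = edgeForm G x + edgeForm G a + ∑ v, x v * nbrSum G a v := by
  have hcross : ∑ v, x v * nbrSum G a v
      = ∑ v, ∑ w, ((if G.Adj v w ∧ v < w then x v * a w else 0)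
          + if G.Adj v w ∧ v < w then x w * a v else 0) := by
    simp_rw [nbrSum, Finset.mul_sum, Finset.sum_add_distrib]
    rw [Finset.sum_comm (f := fun v w => if G.Adj v w ∧ v < w then x w * a v else 0)]
    simp_rw [← Finset.sum_add_distrib]
    refine Finset.sum_congr rfl fun v _ => Finset.sum_congr rfl fun w _ => ?_
    simp only [G.adj_comm w v]
    rcases lt_trichotomy v w with h | rfl | h
    · simp [h, h.not_gt]
    · simp
    · simp [h, h.not_gt]
  rw [hcross]
  simp_rw [edgeForm, ← Finset.sum_add_distrib]
  refine Finset.sum_congr rfl fun v _ => Finset.sum_congr rfl fun w _ => ?_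
  split_ifs <;> ring

theorem sum_mul_nbrSum_self (a : Fin n → ZMod 2) : ∑ v, a v * nbrSum G a v = 0 := by
  have h := edgeForm_add G a a
  simp_rw [CharTwo.add_self_eq_zero] at h
  rw [zero_add] at h
  simpa [edgeForm] using h.symm

theorem qG_eq_card (x : Fin n → Fin 2) :
    qG G x = (univ.filter fun p : Fin n × Fin n =>
      (G.Adj p.1 p.2 ∧ p.1 < p.2) ∧ x p.1 = 1 ∧ x p.2 = 1).card := by
  rw [qG, ← Set.ncard_coe_finset]
  symm
  refine Set.ncard_congr (fun p _ => s(p.1, p.2)) ?_ ?_ ?_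
  · rintro ⟨v, w⟩ h
    simpa using ⟨(by simp at h; exact h.1.1), (by simp at h; exact h.2)⟩
  · rintro ⟨v, w⟩ ⟨v', w'⟩ h h' he
    simp only [coe_filter, mem_univ, true_and, Set.mem_ofPred_eq] at h h'
    rcases Sym2.eq_iff.1 he with ⟨rfl, rfl⟩ | ⟨h1, h2⟩
    · rfl
    · simp only at h1 h2
      subst h1 h2
      exact absurd h.1.2 h'.1.2.not_gt
  · intro e
    induction e with | _ v w
    rintro ⟨hadj, hx⟩
    rw [SimpleGraph.mem_edgeSet] at hadj
    have hv := hx v (by simp)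
    have hw := hx w (by simp)
    rcases lt_or_gt_of_ne hadj.ne with h | h
    · exact ⟨(v, w), by simp [hadj, h, hv, hw], rfl⟩
    · exact ⟨(w, v), by simp [hadj.symm, h, hv, hw], Sym2.eq_swap⟩

theorem qG_cast (x : Fin n → Fin 2) :
    (qG G x : ZMod 2) = edgeForm G (fun v => bitCast (x v)) := by
  rw [qG_eq_card, edgeForm, Finset.card_filter, Nat.cast_sum, Fintype.sum_prod_type]
  refine Finset.sum_congr rfl fun v _ => Finset.sum_congr rfl fun w _ => ?_
  have hbit : ∀ s t : Fin 2,
      (((if s = 1 ∧ t = 1 then 1 else 0 : ℕ)) : ZMod 2) = bitCast s * bitCast t := by decide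
  rw [← hbit]
  by_cases h : G.Adj v w ∧ v < w <;> simp [h]

theorem graphStateVec_eq (x : Fin n → Fin 2) :
    graphStateVec G x
      = ((Real.sqrt 2 : ℂ) ^ n)⁻¹ * signChar (edgeForm G fun v => bitCast (x v)) := by
  rw [graphStateVec, ← qG_cast, signChar_natCast, Fintype.card_fin]

theorem graphStateDM_apply_s8 (x y : Fin n → Fin 2) :
    graphStateDM G x y = (2 ^ n)⁻¹ * (signChar (edgeForm G fun v => bitCast (x v))
      * signChar (edgeForm G fun v => bitCast (y v))) := by
  have hsqrt : ((Real.sqrt 2 : ℂ) ^ n) * ((Real.sqrt 2 : ℂ) ^ n) = 2 ^ n := by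
    rw [← mul_pow, ← Complex.ofReal_mul, Real.mul_self_sqrt (by norm_num)]
    norm_num
  have hconj : (starRingEnd ℂ) (graphStateVec G y) = graphStateVec G y := by
    simp [graphStateVec]
  rw [graphStateDM, Matrix.of_apply, hconj, graphStateVec_eq, graphStateVec_eq, ← hsqrt, mul_inv]
  ring

theorem pauliOp_apply (f : Fin n → Fin 4) (x y : Fin n → Fin 2) :
    pauliOp f x y = if y = (fun v => x v + pauliX (f v)) then
      (∏ v, pauliPhase (f v)) * ∏ v, signChar (bitCast (x v) * pauliZ (f v)) else 0 := by
  rw [pauliOp, Matrix.of_apply]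
  simp_rw [pauli_apply]
  split_ifs with h
  · rw [← Finset.prod_mul_distrib]
    exact Finset.prod_congr rfl fun v _ => if_pos (congrFun h v)
  · obtain ⟨v, hv⟩ := Function.ne_iff.1 h
    exact Finset.prod_eq_zero (Finset.mem_univ v) (if_neg hv)

theorem trace_pauliOp_mul_graphStateDM (f : Fin n → Fin 4) :
    (pauliOp f * graphStateDM G).trace =
      if ∀ v, pauliZ (f v) = nbrSum G (fun w => bitCast (pauliX (f w))) v then
        (∏ v, pauliPhase (f v)) * signChar (edgeForm G fun w => bitCast (pauliX (f w)))
      else 0 := by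
  set a : Fin n → ZMod 2 := fun w => bitCast (pauliX (f w)) with ha
  have hterm : ∀ x : Fin n → Fin 2, (pauliOp f * graphStateDM G) x x =
      (2 ^ n)⁻¹ * ((∏ v, pauliPhase (f v)) * signChar (edgeForm G a))
        * ∏ v, signChar (bitCast (x v) * (pauliZ (f v) + nbrSum G a v)) := by
    intro x
    simp_rw [Matrix.mul_apply, pauliOp_apply, ite_mul, zero_mul]
    rw [Finset.sum_ite_eq' univ, if_pos (mem_univ _), graphStateDM_apply_s8]
    simp_rw [bitCast_add, mul_add, AddChar.map_add_eq_mul]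
    rw [edgeForm_add, AddChar.map_add_eq_mul, AddChar.map_add_eq_mul, Finset.prod_mul_distrib,
      signChar_sum]
    linear_combination (2 ^ n : ℂ)⁻¹ * (∏ v, pauliPhase (f v)) * signChar (edgeForm G a)
      * (∏ v, signChar (bitCast (x v) * pauliZ (f v)))
      * (∏ v, signChar (bitCast (x v) * nbrSum G a v))
      * signChar_mul_self (edgeForm G fun v => bitCast (x v))
  have hsum : ∑ x : Fin n → Fin 2,
      ∏ v, signChar (bitCast (x v) * (pauliZ (f v) + nbrSum G a v))
      = if ∀ v, pauliZ (f v) = nbrSum G a v then 2 ^ n else 0 := by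
    rw [← Fintype.piFinset_univ, ← Finset.prod_univ_sum (fun _ => univ)
      (fun v s => signChar (bitCast s * (pauliZ (f v) + nbrSum G a v)))]
    simp_rw [sum_signChar_bitCast_mul, CharTwo.add_eq_zero]
    rw [Finset.prod_ite_zero]
    simp
  simp_rw [Matrix.trace, Matrix.diag_apply, hterm]
  rw [← Finset.mul_sum, hsum]
  split_ifs
  · field_simp
  · simp

theorem trace_mul_self_pauliOp_mul_graphStateDM (f : Fin n → Fin 4) :
    (pauliOp f * graphStateDM G).trace * (pauliOp f * graphStateDM G).trace =
      if ∀ v, pauliZ (f v) = nbrSum G (fun w => bitCast (pauliX (f w))) v then 1 else 0 := by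
  rw [trace_pauliOp_mul_graphStateDM]
  split_ifs with h
  · rw [mul_mul_mul_comm, signChar_mul_self, ← Finset.prod_mul_distrib]
    simp_rw [pauliPhase_mul_self, h]
    rw [← signChar_sum, sum_mul_nbrSum_self G (fun w => bitCast (pauliX (f w))),
      AddChar.map_zero_eq_one, one_mul]
  · simp

theorem nbrSum_eq_card (f : Fin n → Fin 4) (v : Fin n) :
    nbrSum G (fun w => bitCast (pauliX (f w))) v
      = ((G.neighborFinset v ∩ univ.filter fun w => pauliX (f w) = 1).card : ZMod 2) := by
  have hset : G.neighborFinset v ∩ (univ.filter fun w => pauliX (f w) = 1)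
      = univ.filter fun w => G.Adj v w ∧ pauliX (f w) = 1 := by
    ext w; simp
  have hbit : ∀ s : Fin 2, bitCast s = if s = 1 then 1 else 0 := by decide
  rw [hset, Finset.card_filter, Nat.cast_sum, nbrSum]
  refine Finset.sum_congr rfl fun w _ => ?_
  rw [hbit]
  by_cases h : G.Adj v w <;> simp [h]

end GraphForms

/-- The Pauli label with prescribed flip and phase conditions. -/
def pauliLabel (p q : Prop) [Decidable p] [Decidable q] : Fin 4 :=
  if p then (if q then 2 else 1) else (if q then 3 else 0)

theorem pauliX_pauliLabel (p q : Prop) [Decidable p] [Decidable q] :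
    pauliX (pauliLabel p q) = 1 ↔ p := by
  by_cases p <;> by_cases q <;> simp [pauliX, pauliLabel, *]

theorem pauliZ_pauliLabel (p q : Prop) [Decidable p] [Decidable q] :
    pauliZ (pauliLabel p q) = 1 ↔ q := by
  by_cases p <;> by_cases q <;> simp [pauliZ, pauliLabel, *]

theorem ne_zero_iff_pauliX_or_pauliZ (k : Fin 4) : k ≠ 0 ↔ pauliX k = 1 ∨ pauliZ k = 1 := by
  revert k; decide

theorem pauli_label_ext {k l : Fin 4} (hx : pauliX k = 1 ↔ pauliX l = 1)
    (hz : pauliZ k = 1 ↔ pauliZ l = 1) : k = l := by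
  revert k l; decide

theorem eq_natCast_zmod_two_iff (z : ZMod 2) (k : ℕ) : z = k ↔ (z = 1 ↔ Odd k) := by
  rw [← ZMod.natCast_eq_one_iff_odd]
  generalize (k : ZMod 2) = t
  revert z t; decide

/-- The weight distribution of a graph state counts its stabilizer elements by
weight: `A_j(|G⟩⟨G|)` equals the number of subsets `I ⊆ Fin n` such that
`#{v : v ∈ I or |N(v) ∩ I| is odd} = j`. -/
theorem graphState_weightA_count {n : ℕ} (G : SimpleGraph (Fin n)) [DecidableRel G.Adj]
    (j : ℕ) (hj : j ≤ n) :
    weightA (graphStateDM G) j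
      = ((Finset.univ.filter (fun I : Finset (Fin n) =>
            (Finset.univ.filter (fun v : Fin n =>
              v ∈ I ∨ Odd (G.neighborFinset v ∩ I).card)).card = j)).card : ℂ) := by
  have hodd : ∀ f : Fin n → Fin 4,
      (∀ v, pauliZ (f v) = nbrSum G (fun w => bitCast (pauliX (f w))) v) ↔
        ∀ v, pauliZ (f v) = 1 ↔
          Odd (G.neighborFinset v ∩ univ.filter fun w => pauliX (f w) = 1).card := fun f => by
    simp_rw [nbrSum_eq_card, eq_natCast_zmod_two_iff]
  rw [weightA]
  simp_rw [trace_mul_self_pauliOp_mul_graphStateDM, hodd]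
  rw [Finset.sum_boole, Finset.filter_filter]
  congr 1
  refine Finset.card_nbij' (fun f => univ.filter fun w => pauliX (f w) = 1)
    (fun I v => pauliLabel (v ∈ I) (Odd (G.neighborFinset v ∩ I).card)) ?_ ?_ ?_ ?_
  · intro f hf
    simp only [coe_filter, mem_univ, true_and, Set.mem_ofPred_eq, mem_filter] at hf ⊢
    rw [← hf.1, pauliWt]
    simp_rw [← hf.2, ne_zero_iff_pauliX_or_pauliZ]
  · intro I hI
    simp only [coe_filter, mem_univ, true_and, Set.mem_ofPred_eq] at hI ⊢
    simpa [pauliWt, ne_zero_iff_pauliX_or_pauliZ, pauliX_pauliLabel, pauliZ_pauliLabel] using hI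
  · intro f hf
    simp only [coe_filter, mem_univ, true_and, Set.mem_ofPred_eq] at hf
    funext v
    refine pauli_label_ext ?_ ?_
    · simp [pauliX_pauliLabel]
    · rw [pauliZ_pauliLabel, ← hf.2]
  · intro I _
    ext v
    simp [pauliX_pauliLabel]
end

section
/- Let v₁, …, vₙ be unit vectors in ℂ², and let v : (Fin n → Fin 2) → ℂ be the product vector v(x) = ∏_i v_i(x i). Then the weight distribution of the pure product state ρ = |v⟩⟨v| is binomial: A_j(ρ) = C(n, j) for every 0 ≤ j ≤ n. -/
open Finset

/-- The expectation value `⟨w|σ_k|w⟩` of a single-qubit Pauli matrix. -/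
noncomputable def pauliExpectation (w : Fin 2 → ℂ) (k : Fin 4) : ℂ :=
  ∑ a, ∑ b, pauli k a b * (w b * (starRingEnd ℂ) (w a))

theorem trace_pauliOp_mul_productState {ι : Type} [Fintype ι] [DecidableEq ι]
    (v : ι → Fin 2 → ℂ) (f : ι → Fin 4) :
    (pauliOp f * Matrix.of fun x y : ι → Fin 2 =>
        (∏ i, v i (x i)) * (starRingEnd ℂ) (∏ i, v i (y i))).trace
      = ∏ i, pauliExpectation (v i) (f i) := by
  simp only [pauliExpectation, Matrix.trace, Matrix.diag_apply, Matrix.mul_apply, pauliOp,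
    Matrix.of_apply, map_prod, ← Finset.prod_mul_distrib, Finset.prod_univ_sum,
    Fintype.piFinset_univ]

theorem sum_norm_sq_eq_mul_conj (w : Fin 2 → ℂ) (hw : ∑ b : Fin 2, ‖w b‖ ^ 2 = 1) :
    w 0 * (starRingEnd ℂ) (w 0) + w 1 * (starRingEnd ℂ) (w 1) = 1 := by
  rw [Complex.mul_conj', Complex.mul_conj']
  rw [Fin.sum_univ_two] at hw
  exact_mod_cast hw

theorem pauliExpectation_zero (w : Fin 2 → ℂ) (hw : ∑ b : Fin 2, ‖w b‖ ^ 2 = 1) :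
    pauliExpectation w 0 = 1 := by
  simpa [pauliExpectation, pauli] using sum_norm_sq_eq_mul_conj w hw

/-- The Bloch vector of a pure qubit state has length one. -/
theorem sum_pauliExpectation_sq (w : Fin 2 → ℂ) (hw : ∑ b : Fin 2, ‖w b‖ ^ 2 = 1) :
    ∑ k ∈ Finset.univ.erase (0 : Fin 4), pauliExpectation w k ^ 2 = 1 := by
  have h := sum_norm_sq_eq_mul_conj w hw
  have he : (Finset.univ.erase (0 : Fin 4)) = {1, 2, 3} := by decide
  rw [he]
  simp [pauliExpectation, pauli]
  linear_combination
    (w 0 * (starRingEnd ℂ) (w 0) + w 1 * (starRingEnd ℂ) (w 1) + 1) * h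
      + (w 1 * (starRingEnd ℂ) (w 0) - w 0 * (starRingEnd ℂ) (w 1)) ^ 2 * Complex.I_sq

theorem sum_prod_filter_pauliWt {ι R : Type} [Fintype ι] [DecidableEq ι] [CommSemiring R]
    (g : ι → Fin 4 → R) (h0 : ∀ i, g i 0 = 1)
    (h1 : ∀ i, ∑ k ∈ Finset.univ.erase (0 : Fin 4), g i k = 1) (j : ℕ) :
    ∑ f ∈ Finset.univ.filter (fun f : ι → Fin 4 => pauliWt f = j), ∏ i, g i (f i)
      = ((Fintype.card ι).choose j : R) := by
  have hsupp : ∀ S : Finset ι,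
      ∑ f ∈ Finset.univ.filter (fun f : ι → Fin 4 => (Finset.univ.filter fun i => f i ≠ 0) = S),
        ∏ i, g i (f i) = 1 := by
    intro S
    have hpi : Finset.univ.filter
          (fun f : ι → Fin 4 => (Finset.univ.filter fun i => f i ≠ 0) = S)
        = Fintype.piFinset fun i => if i ∈ S then Finset.univ.erase (0 : Fin 4) else {0} := by
      ext f
      simp only [Finset.mem_filter, Finset.mem_univ, true_and, Fintype.mem_piFinset,
        Finset.ext_iff]
      refine forall_congr' fun i => ?_
      by_cases hi : i ∈ S <;> simp [hi]
    rw [hpi, ← Finset.prod_univ_sum]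
    refine Finset.prod_eq_one fun i _ => ?_
    split_ifs
    · exact h1 i
    · simp [h0 i]
  rw [← Finset.sum_fiberwise_of_maps_to (t := Finset.univ.powersetCard j)
    (g := fun f : ι → Fin 4 => Finset.univ.filter fun i => f i ≠ 0)
    (fun f hf => by simpa [Finset.mem_powersetCard, pauliWt] using hf)]
  rw [Finset.sum_congr rfl (g := fun _ => (1 : R))]
  · simp
  intro S hS
  rw [← hsupp S, Finset.filter_filter]
  refine Finset.sum_congr (Finset.filter_congr fun f _ => ?_) fun _ _ => rfl
  refine and_iff_right_of_imp fun hf => ?_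
  rw [pauliWt, hf, (Finset.mem_powersetCard.mp hS).2]

/-- The weight distribution of a pure product state of `n` unit qubit vectors
is binomial: `A_j(|v⟩⟨v|) = C(n, j)`. -/
theorem productState_weightA_binomial {n : ℕ} (v : Fin n → Fin 2 → ℂ)
    (hv : ∀ i, ∑ b : Fin 2, ‖v i b‖ ^ 2 = 1) (j : ℕ) (hj : j ≤ n) :
    weightA (Matrix.of fun x y : Fin n → Fin 2 =>
        (∏ i, v i (x i)) * (starRingEnd ℂ) (∏ i, v i (y i))) j
      = (n.choose j : ℂ) := by
  simp only [weightA, trace_pauliOp_mul_productState, ← sq, ← Finset.prod_pow]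
  simpa using sum_prod_filter_pauliWt (fun i k => pauliExpectation (v i) k ^ 2)
    (fun i => by simp [pauliExpectation_zero (v i) (hv i)])
    (fun i => sum_pauliExpectation_sq (v i) (hv i)) j
end

section
/- For a pure bipartite state, the purities of the two complementary reductions are equal: let α and β be finite types, v : α × β → ℂ any vector, and ρ = |v⟩⟨v| the matrix with entries v(p)·conj(v(q)). Then tr((tr_β ρ)²) = tr((tr_α ρ)²), where tr_β ρ is the matrix indexed by α with entries (tr_β ρ)(a,a') = ∑_{b ∈ β} ρ((a,b),(a',b)), and tr_α ρ is the matrix indexed by β with entries (tr_α ρ)(b,b') = ∑_{a ∈ α} ρ((a,b),(a,b')). -/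
open Finset

/-- The partial trace over the second factor of an operator on `α × β`. -/
noncomputable def ptraceSnd {α β : Type} [Fintype β]
    (ρ : Matrix (α × β) (α × β) ℂ) : Matrix α α ℂ :=
  Matrix.of fun a a' => ∑ b : β, ρ (a, b) (a', b)

/-- The partial trace over the first factor of an operator on `α × β`. -/
noncomputable def ptraceFst {α β : Type} [Fintype α]
    (ρ : Matrix (α × β) (α × β) ℂ) : Matrix β β ℂ :=
  Matrix.of fun b b' => ∑ a : α, ρ (a, b) (a, b')

/-- The reduction of `|v⟩⟨v|` to the first factor is `A * Aᴴ`, where `A` is the coefficient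
matrix of `v`. -/
theorem ptraceSnd_pure {α β : Type} [Fintype β] (v : α × β → ℂ) :
    ptraceSnd (Matrix.of fun p q : α × β => v p * (starRingEnd ℂ) (v q)) =
      Matrix.of (Function.curry v) * (Matrix.of (Function.curry v)).conjTranspose := by
  ext a a'
  simp [ptraceSnd, Matrix.mul_apply]

/-- The reduction of `|v⟩⟨v|` to the second factor is `(Aᴴ * A)ᵀ`, where `A` is the coefficient
matrix of `v`. -/
theorem ptraceFst_pure {α β : Type} [Fintype α] (v : α × β → ℂ) :
    ptraceFst (Matrix.of fun p q : α × β => v p * (starRingEnd ℂ) (v q)) =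
      ((Matrix.of (Function.curry v)).conjTranspose * Matrix.of (Function.curry v)).transpose := by
  ext b b'
  simp [ptraceFst, Matrix.mul_apply, mul_comm]

/-- For a pure bipartite state `ρ = |v⟩⟨v|`, the purities of the two
complementary reductions are equal: `tr((tr_β ρ)²) = tr((tr_α ρ)²)`. -/
theorem pure_state_complementary_purities {α β : Type} [Fintype α] [Fintype β]
    (v : α × β → ℂ) :
    (ptraceSnd (Matrix.of fun p q : α × β => v p * (starRingEnd ℂ) (v q)) *
       ptraceSnd (Matrix.of fun p q : α × β => v p * (starRingEnd ℂ) (v q))).trace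
      = (ptraceFst (Matrix.of fun p q : α × β => v p * (starRingEnd ℂ) (v q)) *
           ptraceFst (Matrix.of fun p q : α × β => v p * (starRingEnd ℂ) (v q))).trace := by
  rw [ptraceSnd_pure, ptraceFst_pure, ← Matrix.transpose_mul, Matrix.trace_transpose,
    Matrix.mul_assoc, Matrix.trace_mul_comm]
  simp only [Matrix.mul_assoc]
end

section
/- (Cut relations.) Let v : (Fin n → Fin 2) → ℂ be a unit vector and ρ = |v⟩⟨v| the corresponding pure n-qubit state with weight distribution A_j. Then for every 1 ≤ m ≤ n, 2^{−m} · ∑_{j=0}^{m} C(n−j, n−m) · A_j(ρ) = 2^{−(n−m)} · ∑_{j=0}^{n−m} C(n−j, m) · A_j(ρ). -/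
open Finset

/-- The sum of the squared Pauli expectation values over the Pauli labels supported on `T`. -/
noncomputable def supportedSum {ι : Type} [Fintype ι] [DecidableEq ι]
    (ρ : Matrix (ι → Fin 2) (ι → Fin 2) ℂ) (T : Finset ι) : ℂ :=
  ∑ f ∈ Fintype.piFinset (fun i => if i ∈ T then (univ : Finset (Fin 4)) else {0}),
    (pauliOp f * ρ).trace * (pauliOp f * ρ).trace

/-- The matrix entries of the swap operator (for `p`) or of the identity (for `¬ p`) on two
copies of a qubit. -/
def swapKernel (p : Prop) [Decidable p] (x y x' y' : Fin 2) : ℂ :=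
  if p then (if x = y' ∧ x' = y then 1 else 0) else (if x = y ∧ x' = y' then 1 else 0)

theorem swapKernel_swap (p : Prop) [Decidable p] (x y x' y' : Fin 2) :
    swapKernel p x y' x' y = swapKernel (¬ p) x y x' y' := by
  by_cases h : p <;> simp [swapKernel, h]

theorem sum_pauli_mul_pauli_s13 (p : Prop) [Decidable p] (x y x' y' : Fin 2) :
    ∑ a ∈ (if p then (univ : Finset (Fin 4)) else {0}), pauli a x y * pauli a x' y' =
      (if p then 2 else 1) * swapKernel p x y x' y' := by
  by_cases h : p <;> fin_cases x <;> fin_cases y <;> fin_cases x' <;> fin_cases y' <;>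
    simp [swapKernel, h, pauli, Fin.sum_univ_four] <;> norm_num

theorem trace_pauliOp_mul {ι : Type} [Fintype ι] [DecidableEq ι]
    (ρ : Matrix (ι → Fin 2) (ι → Fin 2) ℂ) (f : ι → Fin 4) :
    (pauliOp f * ρ).trace =
      ∑ q : (ι → Fin 2) × (ι → Fin 2), (∏ i, pauli (f i) (q.1 i) (q.2 i)) * ρ q.2 q.1 := by
  simp [Matrix.trace, Matrix.mul_apply, pauliOp, Fintype.sum_prod_type]

theorem supportedSum_eq {ι : Type} [Fintype ι] [DecidableEq ι]
    (ρ : Matrix (ι → Fin 2) (ι → Fin 2) ℂ) (T : Finset ι) :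
    supportedSum ρ T = 2 ^ T.card *
      ∑ x : ι → Fin 2, ∑ y : ι → Fin 2, ∑ x' : ι → Fin 2, ∑ y' : ι → Fin 2,
        (∏ i, swapKernel (i ∈ T) (x i) (y i) (x' i) (y' i)) * (ρ y x * ρ y' x') := by
  have key (x y x' y' : ι → Fin 2) :
      ∑ f ∈ Fintype.piFinset (fun i => if i ∈ T then (univ : Finset (Fin 4)) else {0}),
        (∏ i, pauli (f i) (x i) (y i)) * (∏ i, pauli (f i) (x' i) (y' i)) =
      2 ^ T.card * ∏ i, swapKernel (i ∈ T) (x i) (y i) (x' i) (y' i) := by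
    simp_rw [← prod_mul_distrib]
    rw [← prod_univ_sum (fun i => if i ∈ T then (univ : Finset (Fin 4)) else {0})
      (fun i a => pauli a (x i) (y i) * pauli a (x' i) (y' i))]
    simp_rw [sum_pauli_mul_pauli_s13, prod_mul_distrib]
    simp
  simp_rw [supportedSum, trace_pauliOp_mul, sum_mul_sum]
  rw [sum_comm]
  simp_rw [mul_sum]
  rw [Fintype.sum_prod_type]
  refine sum_congr rfl fun x _ => sum_congr rfl fun y _ => ?_
  rw [sum_comm, Fintype.sum_prod_type]
  refine sum_congr rfl fun x' _ => sum_congr rfl fun y' _ => ?_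
  refine (sum_congr rfl fun f _ => mul_mul_mul_comm _ _ _ _).trans ?_
  rw [← sum_mul, key, mul_assoc]

/-- For a pure state, the reductions to `T` and to `Tᶜ` have the same purity. -/
theorem supportedSum_compl {ι : Type} [Fintype ι] [DecidableEq ι]
    (v : (ι → Fin 2) → ℂ) (T : Finset ι) :
    ((2 : ℂ) ^ T.card)⁻¹ *
        supportedSum (Matrix.of fun x y => v x * (starRingEnd ℂ) (v y)) T =
      ((2 : ℂ) ^ Tᶜ.card)⁻¹ *
        supportedSum (Matrix.of fun x y => v x * (starRingEnd ℂ) (v y)) Tᶜ := by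
  rw [supportedSum_eq, supportedSum_eq, inv_mul_cancel_left₀ (pow_ne_zero _ two_ne_zero),
    inv_mul_cancel_left₀ (pow_ne_zero _ two_ne_zero)]
  refine sum_congr rfl fun x _ => ?_
  rw [sum_comm]
  conv_rhs => rw [sum_comm]
  refine sum_congr rfl fun x' _ => ?_
  conv_lhs => rw [sum_comm]
  refine sum_congr rfl fun y _ => sum_congr rfl fun y' _ => ?_
  have hk (i : ι) : swapKernel (i ∈ T) (x i) (y' i) (x' i) (y i) =
      swapKernel (i ∈ Tᶜ) (x i) (y i) (x' i) (y' i) := by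
    simp [swapKernel_swap (i ∈ T)]
  simp only [Matrix.of_apply, hk]
  ring

theorem card_filter_superset_powersetCard {ι : Type} [Fintype ι] [DecidableEq ι]
    (S : Finset ι) {k : ℕ} (hk : k ≤ Fintype.card ι) :
    ((powersetCard k (univ : Finset ι)).filter (fun T => S ⊆ T)).card =
      (Fintype.card ι - S.card).choose (Fintype.card ι - k) := by
  rw [← card_compl, ← card_powersetCard]
  refine card_bij' (fun T _ => Tᶜ) (fun T _ => Tᶜ) ?_ ?_ (by simp) (by simp)
  · intro T hT
    simp only [mem_filter, mem_powersetCard_univ] at hT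
    simp [mem_powersetCard, card_compl, hT]
  · intro T hT
    simp only [mem_powersetCard] at hT
    simp only [mem_filter, mem_powersetCard_univ, card_compl, hT.2]
    exact ⟨by omega, subset_compl_comm.mp hT.1⟩

theorem sum_choose_mul_weightA {ι : Type} [Fintype ι] [DecidableEq ι]
    (ρ : Matrix (ι → Fin 2) (ι → Fin 2) ℂ) {k : ℕ} (hk : k ≤ Fintype.card ι) :
    ∑ j ∈ range (k + 1), ((Fintype.card ι - j).choose (Fintype.card ι - k) : ℂ) * weightA ρ j =
      ∑ T ∈ powersetCard k (univ : Finset ι), supportedSum ρ T := by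
  have hsupp (T : Finset ι) :
      Fintype.piFinset (fun i => if i ∈ T then (univ : Finset (Fin 4)) else {0}) =
        univ.filter (fun f : ι → Fin 4 => (univ.filter fun i => f i ≠ 0) ⊆ T) := by
    ext f
    simp only [Fintype.mem_piFinset, mem_filter, mem_univ, true_and, subset_iff]
    refine forall_congr' fun i => ?_
    by_cases h : i ∈ T <;> simp [h]
  simp_rw [supportedSum, hsupp, weightA, sum_filter, mul_sum]
  rw [sum_comm, sum_comm (s := powersetCard k univ)]
  refine sum_congr rfl fun f _ => ?_
  rw [← sum_filter, sum_const, card_filter_superset_powersetCard _ hk, nsmul_eq_mul]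
  simp only [mul_ite, mul_zero, sum_ite_eq, mem_range]
  split_ifs with h
  · rfl
  · have hlt : Fintype.card ι - pauliWt f < Fintype.card ι - k := by
      have : pauliWt f ≤ Fintype.card ι := card_le_univ _
      omega
    change _ = ((Fintype.card ι - pauliWt f).choose _ : ℂ) * _
    simp [Nat.choose_eq_zero_of_lt hlt]

/-- Cut relations: for a pure `n`-qubit state `ρ = |v⟩⟨v|` and every `1 ≤ m ≤ n`,
`2^{-m} ∑_{j=0}^{m} C(n-j, n-m) A_j(ρ) = 2^{-(n-m)} ∑_{j=0}^{n-m} C(n-j, m) A_j(ρ)`. -/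
theorem cut_relations {n : ℕ} (v : (Fin n → Fin 2) → ℂ)
    (hv : ∑ x : Fin n → Fin 2, ‖v x‖ ^ 2 = 1) (m : ℕ) (hm : 1 ≤ m) (hmn : m ≤ n) :
    ((2 : ℂ) ^ m)⁻¹ *
        ∑ j ∈ Finset.range (m + 1), ((n - j).choose (n - m) : ℂ) *
          weightA (Matrix.of fun x y => v x * (starRingEnd ℂ) (v y)) j
      = ((2 : ℂ) ^ (n - m))⁻¹ *
          ∑ j ∈ Finset.range (n - m + 1), ((n - j).choose m : ℂ) *
            weightA (Matrix.of fun x y => v x * (starRingEnd ℂ) (v y)) j := by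
  have hL := sum_choose_mul_weightA (ι := Fin n)
    (Matrix.of fun x y => v x * (starRingEnd ℂ) (v y)) (k := m) (by simpa using hmn)
  have hR := sum_choose_mul_weightA (ι := Fin n)
    (Matrix.of fun x y => v x * (starRingEnd ℂ) (v y)) (k := n - m) (by simp)
  simp only [Fintype.card_fin, Nat.sub_sub_self hmn] at hL hR
  rw [hL, hR, mul_sum, mul_sum]
  refine sum_bij' (fun T _ => Tᶜ) (fun T _ => Tᶜ) ?_ ?_ (by simp) (by simp) ?_
  · intro T hT
    simp_all [card_compl]
  · intro T hT
    simp_all [card_compl, Nat.sub_sub_self hmn]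
  · intro T hT
    have h := supportedSum_compl v T
    rw [mem_powersetCard_univ] at hT
    rwa [card_compl, hT, Fintype.card_fin] at h
end

section
/- Let ρ be a positive semidefinite Hermitian n-qubit operator with weight distribution A_j. Then for every 1 ≤ m ≤ n, the alternating sum of the reduced weight distribution is nonnegative: ∑_{j=0}^{m} (−1)^j · C(n−j, n−m) · A_j(ρ) ≥ 0. -/
open Finset

open scoped ComplexOrder Kronecker in
/-- If each one-site weighted sum of `σ_a ⊗ σ_a` factors as `u uᴴ`, then the correspondingly
weighted sum of squared Pauli coefficients of a positive semidefinite operator is nonnegative. -/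
theorem sum_prod_mul_trace_pauliOp_sq_nonneg {ι κ : Type} [Fintype ι] [DecidableEq ι]
    [Fintype κ] {ρ : Matrix (ι → Fin 2) (ι → Fin 2) ℂ} (hρ : ρ.PosSemidef)
    (c : ι → Fin 4 → ℂ) (u : ι → κ → Fin 2 → Fin 2 → ℂ)
    (hu : ∀ i x x' y y', ∑ a, c i a * (pauli a x y * pauli a x' y') =
      ∑ k, u i k x x' * star (u i k y y')) :
    0 ≤ ∑ f : ι → Fin 4,
      (∏ i, c i (f i)) * ((pauliOp f * ρ).trace * (pauliOp f * ρ).trace) := by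
  classical
  let V : Matrix ((ι → Fin 2) × (ι → Fin 2)) (ι → κ) ℂ :=
    Matrix.of fun p k => ∏ i, u i (k i) (p.1 i) (p.2 i)
  have hV : ∑ f : ι → Fin 4, (∏ i, c i (f i)) • (pauliOp f ⊗ₖ pauliOp f) =
      V * V.conjTranspose := by
    ext ⟨x, x'⟩ ⟨y, y'⟩
    simp only [Matrix.sum_apply, Matrix.smul_apply, Matrix.kronecker_apply, pauliOp,
      Matrix.of_apply, smul_eq_mul, Matrix.mul_apply, Matrix.conjTranspose_apply, V, star_prod,
      ← Finset.prod_mul_distrib]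
    rw [← Fintype.prod_sum (fun i a => c i a * (pauli a (x i) (y i) * pauli a (x' i) (y' i))),
      ← Fintype.prod_sum (fun i k => u i k (x i) (x' i) * star (u i k (y i) (y' i)))]
    exact Finset.prod_congr rfl fun i _ => hu i _ _ _ _
  have htrace : ∑ f : ι → Fin 4,
      (∏ i, c i (f i)) * ((pauliOp f * ρ).trace * (pauliOp f * ρ).trace) =
      (V.conjTranspose * (ρ ⊗ₖ ρ) * V).trace := by
    rw [Matrix.trace_mul_comm, ← Matrix.mul_assoc, ← hV, Finset.sum_mul, Matrix.trace_sum]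
    refine Finset.sum_congr rfl fun f _ => ?_
    rw [Matrix.smul_mul, ← Matrix.mul_kronecker_mul, Matrix.trace_smul, Matrix.trace_kronecker,
      smul_eq_mul]
  rw [htrace]
  exact ((hρ.kronecker hρ).conjTranspose_mul_mul_same V).trace_nonneg

/-- The identity on two qubits factors through the standard basis. -/
theorem pauli_zero_mul_pauli_zero (x x' y y' : Fin 2) :
    pauli 0 x y * pauli 0 x' y' =
      ∑ k : Fin 2 × Fin 2, (if k = (x, x') then 1 else 0) *
        star (if k = (y, y') then (1 : ℂ) else 0) := by
  fin_cases x <;> fin_cases x' <;> fin_cases y <;> fin_cases y' <;>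
    simp [pauli]

/-- `I ⊗ I - X ⊗ X - Y ⊗ Y - Z ⊗ Z` is a positive multiple of the singlet projector. -/
theorem sum_sign_mul_pauli_mul_pauli (x x' y y' : Fin 2) :
    ∑ a : Fin 4, (if a = 0 then 1 else -1) * (pauli a x y * pauli a x' y') =
      ∑ k : Fin 2 × Fin 2, (if k.1 = k.2 then !![0, 1; -1, 0] x x' else 0) *
        star (if k.1 = k.2 then (!![0, 1; -1, 0] : Matrix (Fin 2) (Fin 2) ℂ) y y' else 0) := by
  fin_cases x <;> fin_cases x' <;> fin_cases y <;> fin_cases y' <;>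
    simp [pauli, Fintype.sum_prod_type, Fin.sum_univ_four] <;> norm_num

open scoped ComplexOrder in
/-- The signed sum of squared Pauli coefficients over labels that vanish on `S` is nonnegative. -/
theorem sum_sign_mul_trace_pauliOp_sq_nonneg {ι : Type} [Fintype ι] [DecidableEq ι]
    {ρ : Matrix (ι → Fin 2) (ι → Fin 2) ℂ} (hρ : ρ.PosSemidef) (S : Finset ι) :
    0 ≤ ∑ f : ι → Fin 4 with ∀ i ∈ S, f i = 0,
      (-1 : ℂ) ^ pauliWt f * ((pauliOp f * ρ).trace * (pauliOp f * ρ).trace) := by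
  have h := sum_prod_mul_trace_pauliOp_sq_nonneg hρ
    (fun i a => if a = 0 then 1 else if i ∈ S then 0 else -1)
    (fun i (k : Fin 2 × Fin 2) x x' => if i ∈ S then (if k = (x, x') then 1 else 0)
      else if k.1 = k.2 then !![0, 1; -1, 0] x x' else 0) (by
      intro i x x' y y'
      by_cases hi : i ∈ S
      · simpa [hi] using pauli_zero_mul_pauli_zero x x' y y'
      · simpa only [hi, if_false] using sum_sign_mul_pauli_mul_pauli x x' y y')
  convert h using 1
  rw [Finset.sum_filter]
  refine Finset.sum_congr rfl fun f _ => ?_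
  split_ifs with hf
  · congr 1
    rw [pauliWt, ← Finset.prod_const, Finset.prod_filter]
    refine Finset.prod_congr rfl fun i _ => ?_
    by_cases hi : f i = 0
    · simp [hi]
    · simp [hi, mt (hf i) hi]
  · push Not at hf
    obtain ⟨i, hi, hfi⟩ := hf
    rw [Finset.prod_eq_zero (Finset.mem_univ i) (by simp [hi, hfi]), zero_mul]

/-- The number of `k`-subsets of the sites where a Pauli label is trivial. -/
theorem card_filter_powersetCard_pauli_zero {ι : Type} [Fintype ι] [DecidableEq ι]
    (f : ι → Fin 4) (k : ℕ) :
    #{S ∈ powersetCard k (univ : Finset ι) | ∀ i ∈ S, f i = 0} =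
      (Fintype.card ι - pauliWt f).choose k := by
  have hzero : #{i | f i = 0} = Fintype.card ι - pauliWt f := by
    have := Finset.card_filter_add_card_filter_not (s := (univ : Finset ι)) (fun i => f i = 0)
    rw [Finset.card_univ] at this
    simp only [pauliWt, ne_eq]
    omega
  rw [← hzero, ← Finset.card_powersetCard]
  congr 1
  ext S
  simp [mem_powersetCard, subset_iff, and_comm]

open scoped ComplexOrder in
/-- For a positive semidefinite `n`-qubit operator, the alternating sum of the
reduced weight distribution is nonnegative:
`∑_{j=0}^{m} (-1)^j C(n-j, n-m) A_j(ρ) ≥ 0` for every `1 ≤ m ≤ n`. -/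
theorem alternating_reduced_weightA_nonneg {n : ℕ}
    (ρ : Matrix (Fin n → Fin 2) (Fin n → Fin 2) ℂ) (hρ : ρ.PosSemidef)
    (m : ℕ) (hm : 1 ≤ m) (hmn : m ≤ n) :
    0 ≤ ∑ j ∈ Finset.range (m + 1),
        (-1 : ℂ) ^ j * ((n - j).choose (n - m) : ℂ) * weightA ρ j := by
  have hsum : ∑ j ∈ Finset.range (m + 1),
        (-1 : ℂ) ^ j * ((n - j).choose (n - m) : ℂ) * weightA ρ j =
      ∑ S ∈ powersetCard (n - m) (univ : Finset (Fin n)),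
        ∑ f : Fin n → Fin 4 with ∀ i ∈ S, f i = 0,
          (-1 : ℂ) ^ pauliWt f * ((pauliOp f * ρ).trace * (pauliOp f * ρ).trace) := by
    simp only [weightA, Finset.mul_sum, Finset.sum_filter, mul_ite, mul_zero]
    rw [Finset.sum_comm, Finset.sum_comm (s := powersetCard _ _)]
    refine Finset.sum_congr rfl fun f _ => ?_
    have hcard : #{S ∈ powersetCard (n - m) (univ : Finset (Fin n)) | ∀ i ∈ S, f i = 0} =
        (n - pauliWt f).choose (n - m) := by
      convert card_filter_powersetCard_pauli_zero f (n - m)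
      exact (Fintype.card_fin n).symm
    rw [Finset.sum_ite_eq, ← Finset.sum_filter, Finset.sum_const, hcard, nsmul_eq_mul]
    split_ifs with hf
    · ring
    · have hwt : pauliWt f ≤ n := (Finset.card_le_univ _).trans_eq (Fintype.card_fin n)
      rw [Finset.mem_range] at hf
      rw [Nat.choose_eq_zero_of_lt (by omega)]
      simp
  rw [hsum]
  refine Finset.sum_nonneg fun S _ => ?_
  convert sum_sign_mul_trace_pauliOp_sq_nonneg hρ S
end

section
/- (Shadow inequality of Rains.) Let M and N be positive semidefinite Hermitian n-qubit operators and let T ⊆ Fin n be any subset. Then ∑_{S ⊆ Fin n} (−1)^{|S ∩ T|} · tr( tr_{Sᶜ}(M) · tr_{Sᶜ}(N) ) ≥ 0, where the sum runs over all subsets S of Fin n and tr_{Sᶜ} denotes the partial trace over the qubits outside S. -/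
open Finset

theorem sum_eq_sum_combineOn {n : ℕ} (S : Finset (Fin n)) (f : (Fin n → Fin 2) → ℂ) :
    ∑ x, f x = ∑ a, ∑ b, f (combineOn S a b) := by
  rw [← Fintype.sum_prod_type']
  exact ((Equiv.piEquivPiSubtypeProd (fun v => v ∈ S) (fun _ => Fin 2)).symm.sum_comp f).symm

/-- The matrix entries of the operator swapping the two copies of the qubits in `S`. -/
noncomputable def partialSwap {n : ℕ} (S : Finset (Fin n)) (p q : Fin n → Fin 2 × Fin 2) : ℂ :=
  (∏ i ∈ S, if p i = (q i).swap then 1 else 0) * ∏ i ∈ Sᶜ, if p i = q i then 1 else 0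

theorem partialSwap_combineOn {n : ℕ} (S : Finset (Fin n))
    (a₁ a₂ a₃ a₄ : {v : Fin n // v ∈ S} → Fin 2) (b₁ b₂ b₃ b₄ : {v : Fin n // v ∉ S} → Fin 2) :
    partialSwap S (fun i => (combineOn S a₁ b₁ i, combineOn S a₂ b₂ i))
      (fun i => (combineOn S a₃ b₃ i, combineOn S a₄ b₄ i)) =
    if a₄ = a₁ then if a₃ = a₂ then if b₃ = b₁ then if b₄ = b₂ then 1 else 0 else 0 else 0
      else 0 := by
  have h₁ : (∀ i ∈ S, (combineOn S a₁ b₁ i, combineOn S a₂ b₂ i) =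
      (combineOn S a₃ b₃ i, combineOn S a₄ b₄ i).swap) ↔ a₄ = a₁ ∧ a₃ = a₂ := by
    simp only [Prod.swap_prod_mk, Prod.mk.injEq, funext_iff, Subtype.forall, ← forall_and]
    refine forall₂_congr fun i hi => ?_
    simp [combineOn, hi, eq_comm]
  have h₂ : (∀ i ∈ Sᶜ, (combineOn S a₁ b₁ i, combineOn S a₂ b₂ i) =
      (combineOn S a₃ b₃ i, combineOn S a₄ b₄ i)) ↔ b₃ = b₁ ∧ b₄ = b₂ := by
    simp only [Prod.mk.injEq, funext_iff, Subtype.forall, ← forall_and, mem_compl]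
    refine forall₂_congr fun i hi => ?_
    simp [combineOn, hi, eq_comm]
  rw [partialSwap, prod_ite_zero, prod_ite_zero]
  simp only [h₁, h₂, prod_const_one, ite_and]
  split_ifs <;> simp

theorem trace_reduceTo_mul_reduceTo {n : ℕ} (M N : Matrix (Fin n → Fin 2) (Fin n → Fin 2) ℂ)
    (S : Finset (Fin n)) :
    (reduceTo M S * reduceTo N S).trace =
      ∑ x, ∑ y, ∑ x', ∑ y', M x x' * N y y' *
        partialSwap S (fun i => (x i, y i)) (fun i => (x' i, y' i)) := by
  simp only [sum_eq_sum_combineOn S, partialSwap_combineOn, mul_ite, mul_one, mul_zero]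
  simp only [Matrix.trace, Matrix.diag, Matrix.mul_apply, reduceTo, Matrix.of_apply, sum_mul_sum]
  refine sum_congr rfl fun a _ => ?_
  rw [sum_comm]
  simp [sum_ite_irrel]

/-- The one-site kernel of `1 + ε F`, where `F` swaps two qubits. -/
noncomputable def siteKernel (ε : ℂ) (p q : Fin 2 × Fin 2) : ℂ :=
  ε * (if p = q.swap then 1 else 0) + if p = q then 1 else 0

theorem sum_siteKernel_mul (ε : ℂ) (hε : ε = 1 ∨ ε = -1) (p q : Fin 2 × Fin 2) :
    ∑ r, siteKernel ε p r * siteKernel ε q r = 2 * siteKernel ε p q := by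
  obtain ⟨a, b⟩ := p
  obtain ⟨c, d⟩ := q
  rcases hε with rfl | rfl <;>
    fin_cases a <;> fin_cases b <;> fin_cases c <;> fin_cases d <;>
    norm_num [siteKernel, Fintype.sum_prod_type]

theorem star_siteKernel (ε : ℂ) (hε : star ε = ε) (p q : Fin 2 × Fin 2) :
    star (siteKernel ε p q) = siteKernel ε p q := by
  simp only [siteKernel, star_add, star_mul', hε, apply_ite star, star_one, star_zero]

theorem sum_sign_mul_partialSwap {n : ℕ} (T : Finset (Fin n)) (p q : Fin n → Fin 2 × Fin 2) :
    ∑ S : Finset (Fin n), (-1 : ℂ) ^ (S ∩ T).card * partialSwap S p q =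
      ∏ i, siteKernel (if i ∈ T then -1 else 1) (p i) (q i) := by
  simp only [siteKernel, Fintype.prod_add, prod_mul_distrib]
  refine sum_congr rfl fun S _ => ?_
  rw [partialSwap, ← mul_assoc, prod_ite_mem, prod_const]

/-- The tensor product over all sites of the kernels of `1 ± F`, with sign `-` on `T`. -/
noncomputable def shadowFactor {n : ℕ} (T : Finset (Fin n)) :
    Matrix ((Fin n → Fin 2) × (Fin n → Fin 2)) (Fin n → Fin 2 × Fin 2) ℂ :=
  Matrix.of fun p q => ∏ i, siteKernel (if i ∈ T then -1 else 1) (p.1 i, p.2 i) (q i)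

theorem shadowFactor_mul_conjTranspose {n : ℕ} (T : Finset (Fin n))
    (p q : (Fin n → Fin 2) × (Fin n → Fin 2)) :
    (shadowFactor T * (shadowFactor T).conjTranspose) p q = 2 ^ n *
      ∏ i, siteKernel (if i ∈ T then -1 else 1) (p.1 i, p.2 i) (q.1 i, q.2 i) := by
  have hs (i : Fin n) : star (if i ∈ T then (-1 : ℂ) else 1) = if i ∈ T then -1 else 1 := by
    split_ifs <;> simp
  have hsq (i : Fin n) : (if i ∈ T then (-1 : ℂ) else 1) = 1 ∨
      (if i ∈ T then (-1 : ℂ) else 1) = -1 := by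
    split_ifs <;> simp
  simp only [Matrix.mul_apply, Matrix.conjTranspose_apply, shadowFactor, Matrix.of_apply,
    star_prod, star_siteKernel _ (hs _), ← prod_mul_distrib]
  rw [← Fintype.prod_sum (fun i r => siteKernel (if i ∈ T then -1 else 1) (p.1 i, p.2 i) r *
    siteKernel (if i ∈ T then -1 else 1) (q.1 i, q.2 i) r)]
  simp [sum_siteKernel_mul _ (hsq _), prod_mul_distrib]

theorem siteKernel_comm (ε : ℂ) (p q : Fin 2 × Fin 2) : siteKernel ε p q = siteKernel ε q p := by
  simp only [siteKernel, eq_comm (a := p), Prod.swap_eq_iff_eq_swap]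

open scoped Kronecker in
theorem two_pow_mul_shadow_sum {n : ℕ} (M N : Matrix (Fin n → Fin 2) (Fin n → Fin 2) ℂ)
    (T : Finset (Fin n)) :
    2 ^ n * ∑ S : Finset (Fin n), (-1 : ℂ) ^ (S ∩ T).card * (reduceTo M S * reduceTo N S).trace =
      ((shadowFactor T).conjTranspose * (M ⊗ₖ N) * shadowFactor T).trace := by
  rw [Matrix.mul_assoc, Matrix.trace_mul_comm, Matrix.mul_assoc]
  simp only [trace_reduceTo_mul_reduceTo, mul_sum]
  simp only [Matrix.trace, Matrix.diag, Matrix.mul_apply (M := M ⊗ₖ N),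
    shadowFactor_mul_conjTranspose, Matrix.kronecker_apply, Fintype.sum_prod_type]
  rw [sum_comm]
  refine sum_congr rfl fun x _ => ?_
  rw [sum_comm]
  refine sum_congr rfl fun y _ => ?_
  rw [sum_comm]
  refine sum_congr rfl fun x' _ => ?_
  rw [sum_comm]
  refine sum_congr rfl fun y' _ => ?_
  have h := sum_sign_mul_partialSwap T (fun i => (x i, y i)) (fun i => (x' i, y' i))
  simp only [siteKernel_comm _ (x' _, y' _)]
  rw [← h, mul_sum, mul_sum]
  exact sum_congr rfl fun S _ => by ring

open scoped ComplexOrder in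
/-- The shadow inequality of Rains: for positive semidefinite `n`-qubit
operators `M`, `N` and any subset `T`,
`∑_{S ⊆ {1..n}} (-1)^{|S ∩ T|} tr(tr_{Sᶜ}(M) · tr_{Sᶜ}(N)) ≥ 0`. -/
theorem shadow_inequality {n : ℕ}
    (M N : Matrix (Fin n → Fin 2) (Fin n → Fin 2) ℂ)
    (hM : M.PosSemidef) (hN : N.PosSemidef) (T : Finset (Fin n)) :
    0 ≤ ∑ S : Finset (Fin n),
        (-1 : ℂ) ^ (S ∩ T).card * (reduceTo M S * reduceTo N S).trace := by
  have h : 0 ≤ (2 : ℂ) ^ n * ∑ S : Finset (Fin n),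
      (-1 : ℂ) ^ (S ∩ T).card * (reduceTo M S * reduceTo N S).trace := by
    rw [two_pow_mul_shadow_sum]
    exact ((hM.kronecker hN).conjTranspose_mul_mul_same _).trace_nonneg
  have h2 : (0 : ℂ) < 2 ^ n := pow_pos (zero_lt_two' ℂ) n
  simpa [inv_mul_cancel_left₀ h2.ne'] using mul_nonneg (inv_pos.2 h2).le h
end

section
/- Let ρ be a positive semidefinite Hermitian n-qubit operator with weight distribution A_k. Then for all 0 ≤ j ≤ m ≤ n, the averaged shadow coefficients of the m-body reductions are nonnegative: ∑_{k=0}^{m} (−1)^k · K_j(k, m) · C(n−k, n−m) · A_k(ρ) ≥ 0, where K_j(k, m) = ∑_{α=0}^{j} (−1)^α · 3^{j−α} · C(m−k, j−α) · C(k, α) is the Krawtchouk polynomial. -/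
open Finset

/-- The Krawtchouk polynomial
`K_j(k, m) = ∑_{α=0}^{j} (-1)^α 3^{j-α} C(m-k, j-α) C(k, α)`. -/
def krawtchouk (j k m : ℕ) : ℤ :=
  ∑ α ∈ Finset.range (j + 1),
    (-1 : ℤ) ^ α * 3 ^ (j - α) * ((m - k).choose (j - α)) * (k.choose α)

open scoped Kronecker ComplexOrder

section Tensor

variable {ι α : Type} [Fintype ι]

/-- The tensor product of a family of square matrices, indexed by functions. -/
def tensorMatrix (A : ι → Matrix α α ℂ) : Matrix (ι → α) (ι → α) ℂ :=
  Matrix.of fun x y => ∏ i, A i (x i) (y i)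

lemma tensorMatrix_mul [DecidableEq ι] [Fintype α] (A B : ι → Matrix α α ℂ) :
    tensorMatrix (fun i => A i * B i) = tensorMatrix A * tensorMatrix B := by
  ext x y
  simp only [tensorMatrix, Matrix.of_apply, Matrix.mul_apply, Finset.prod_univ_sum,
    Fintype.piFinset_univ, Finset.prod_mul_distrib]

lemma tensorMatrix_conjTranspose (A : ι → Matrix α α ℂ) :
    tensorMatrix (fun i => (A i).conjTranspose) = (tensorMatrix A).conjTranspose := by
  ext x y
  simp [tensorMatrix, Matrix.conjTranspose_apply]

lemma tensorMatrix_sum_smul [DecidableEq ι] {κ : Type} [Fintype κ]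
    (c : ι → κ → ℂ) (A : κ → Matrix α α ℂ) :
    tensorMatrix (fun i => ∑ a, c i a • A a) =
      ∑ f : ι → κ, (∏ i, c i (f i)) • tensorMatrix (fun i => A (f i)) := by
  ext x y
  simp only [tensorMatrix, Matrix.of_apply, Matrix.sum_apply, Matrix.smul_apply, smul_eq_mul,
    Finset.prod_univ_sum, Fintype.piFinset_univ, Finset.prod_mul_distrib]

lemma trace_tensorMatrix_mul_nonneg [DecidableEq ι] [Fintype α] [DecidableEq α]
    (A : ι → Matrix α α ℂ) (hA : ∀ i, ∃ B : Matrix α α ℂ, A i = B.conjTranspose * B)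
    {R : Matrix (ι → α) (ι → α) ℂ} (hR : R.PosSemidef) :
    0 ≤ (tensorMatrix A * R).trace := by
  choose B hB using hA
  have h : tensorMatrix A = (tensorMatrix B).conjTranspose * tensorMatrix B := by
    rw [← tensorMatrix_conjTranspose, ← tensorMatrix_mul]
    exact congrArg tensorMatrix (funext hB)
  rw [h, Matrix.mul_assoc, Matrix.trace_mul_comm]
  exact (hR.mul_mul_conjTranspose_same _).trace_nonneg

end Tensor

section PauliPairs

variable {ι : Type} [Fintype ι] [DecidableEq ι]

lemma trace_tensorMatrix_pauli_mul (ρ : Matrix (ι → Fin 2) (ι → Fin 2) ℂ) (f : ι → Fin 4) :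
    (tensorMatrix (fun i => pauli (f i) ⊗ₖ pauli (f i)) *
      (ρ ⊗ₖ ρ).submatrix (Equiv.arrowProdEquivProdArrow ι (fun _ => Fin 2) (fun _ => Fin 2))
        (Equiv.arrowProdEquivProdArrow ι (fun _ => Fin 2) (fun _ => Fin 2))).trace =
      (pauliOp f * ρ).trace * (pauliOp f * ρ).trace := by
  have h : tensorMatrix (fun i => pauli (f i) ⊗ₖ pauli (f i)) =
      (pauliOp f ⊗ₖ pauliOp f).submatrix
        (Equiv.arrowProdEquivProdArrow ι (fun _ => Fin 2) (fun _ => Fin 2))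
        (Equiv.arrowProdEquivProdArrow ι (fun _ => Fin 2) (fun _ => Fin 2)) := by
    ext x y
    simp [tensorMatrix, pauliOp, Matrix.kroneckerMap_apply, Finset.prod_mul_distrib]
  rw [h, Matrix.submatrix_mul_equiv, ← Matrix.mul_kronecker_mul, ← Matrix.trace_kronecker]
  exact Equiv.sum_comp (Equiv.arrowProdEquivProdArrow ι (fun _ => Fin 2) (fun _ => Fin 2))
    (fun p => ((pauliOp f * ρ) ⊗ₖ (pauliOp f * ρ)) p p)

lemma sum_prod_mul_trace_sq_nonneg {ρ : Matrix (ι → Fin 2) (ι → Fin 2) ℂ} (hρ : ρ.PosSemidef)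
    (c : ι → Fin 4 → ℂ)
    (hc : ∀ i, ∃ B : Matrix (Fin 2 × Fin 2) (Fin 2 × Fin 2) ℂ,
      ∑ a, c i a • (pauli a ⊗ₖ pauli a) = B.conjTranspose * B) :
    0 ≤ ∑ f : ι → Fin 4, (∏ i, c i (f i)) *
      ((pauliOp f * ρ).trace * (pauliOp f * ρ).trace) := by
  have h := trace_tensorMatrix_mul_nonneg _ hc ((hρ.kronecker hρ).submatrix
    (Equiv.arrowProdEquivProdArrow ι (fun _ => Fin 2) (fun _ => Fin 2)))
  rw [tensorMatrix_sum_smul c fun a => pauli a ⊗ₖ pauli a, Matrix.sum_mul, Matrix.trace_sum] at h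
  simpa only [Matrix.smul_mul, Matrix.trace_smul, trace_tensorMatrix_pauli_mul, smul_eq_mul]
    using h

end PauliPairs

/-- The operator `1 + s • SWAP` on two qubits. -/
def oneAddSwap (s : ℂ) : Matrix (Fin 2 × Fin 2) (Fin 2 × Fin 2) ℂ :=
  Matrix.of fun p q => (if p = q then 1 else 0) + s * (if p = q.swap then 1 else 0)

/-- Site coefficients: `2(1 + SWAP)` on `T`, `2(1 - SWAP)` on `S \ T`, identity off `S`. -/
def siteCoeff {ι : Type} [DecidableEq ι] (S T : Finset ι) (i : ι) (a : Fin 4) : ℂ :=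
  if i ∈ T then (if a = 0 then 3 else 1)
  else if i ∈ S then (if a = 0 then 1 else -1)
  else (if a = 0 then 1 else 0)

lemma exists_sum_siteCoeff_eq {ι : Type} [DecidableEq ι] (S T : Finset ι) (i : ι) :
    ∃ B : Matrix (Fin 2 × Fin 2) (Fin 2 × Fin 2) ℂ,
      ∑ a, siteCoeff S T i a • (pauli a ⊗ₖ pauli a) = B.conjTranspose * B := by
  by_cases hT : i ∈ T
  · refine ⟨oneAddSwap 1, ?_⟩
    ext ⟨x, x'⟩ ⟨y, y'⟩
    fin_cases x <;> fin_cases x' <;> fin_cases y <;> fin_cases y' <;>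
      simp [Fin.sum_univ_four, siteCoeff, hT, pauli, oneAddSwap, Matrix.mul_apply,
        Fintype.sum_prod_type, Matrix.kroneckerMap_apply] <;> norm_num
  by_cases hS : i ∈ S
  · refine ⟨oneAddSwap (-1), ?_⟩
    ext ⟨x, x'⟩ ⟨y, y'⟩
    fin_cases x <;> fin_cases x' <;> fin_cases y <;> fin_cases y' <;>
      simp [Fin.sum_univ_four, siteCoeff, hT, hS, pauli, oneAddSwap, Matrix.mul_apply,
        Fintype.sum_prod_type, Matrix.kroneckerMap_apply]
  · refine ⟨1, ?_⟩
    ext ⟨x, x'⟩ ⟨y, y'⟩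
    fin_cases x <;> fin_cases x' <;> fin_cases y <;> fin_cases y' <;>
      simp [siteCoeff, hT, hS, pauli, Matrix.kroneckerMap_apply]

section Counting

variable {ι : Type} [DecidableEq ι]

lemma card_powersetCard_filter_inter {S F : Finset ι} (hFS : F ⊆ S) {j α : ℕ} (hα : α ≤ j) :
    ((S.powersetCard j).filter fun T => (T ∩ F).card = α).card =
      (F.card.choose α) * ((S.card - F.card).choose (j - α)) := by
  rw [← Finset.card_sdiff_of_subset hFS, ← Finset.card_powersetCard,
    ← Finset.card_powersetCard, ← Finset.card_product]
  refine Finset.card_bij' (fun T _ => (T ∩ F, T \ F)) (fun p _ => p.1 ∪ p.2) ?_ ?_ ?_ ?_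
  · intro T hT
    simp only [mem_filter, mem_powersetCard, mem_product] at hT ⊢
    have := Finset.card_inter_add_card_sdiff T F
    exact ⟨⟨inter_subset_right, hT.2⟩, sdiff_subset_sdiff hT.1.1 le_rfl, by lia⟩
  · rintro ⟨U, V⟩ h
    simp only [mem_filter, mem_powersetCard, mem_product] at h ⊢
    obtain ⟨⟨hU, hUc⟩, hV, hVc⟩ := h
    have hd : Disjoint U V := Disjoint.mono hU hV disjoint_sdiff
    have hi : (U ∪ V) ∩ F = U := by
      ext x
      have := @hU x
      have := @hV x
      simp only [mem_inter, mem_union, mem_sdiff] at *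
      tauto
    refine ⟨⟨union_subset (hU.trans hFS) (hV.trans sdiff_subset), ?_⟩, by rw [hi, hUc]⟩
    rw [card_union_of_disjoint hd]
    lia
  · intro T _
    ext x
    simp only [mem_inter, mem_union, mem_sdiff]
    tauto
  · rintro ⟨U, V⟩ h
    simp only [mem_powersetCard, mem_product] at h
    obtain ⟨⟨hU, -⟩, hV, -⟩ := h
    ext x <;>
    · have := @hU x
      have := @hV x
      simp only [mem_inter, mem_union, mem_sdiff] at *
      tauto

lemma card_powersetCard_filter_superset [Fintype ι] (F : Finset ι) {m : ℕ}
    (hm : m ≤ Fintype.card ι) :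
    (((univ : Finset ι).powersetCard m).filter fun S => F ⊆ S).card =
      (Fintype.card ι - F.card).choose (Fintype.card ι - m) := by
  rw [← Finset.card_compl, ← Finset.card_powersetCard]
  refine Finset.card_bij' (fun S _ => Sᶜ) (fun S _ => Sᶜ) ?_ ?_ (by simp) (by simp)
  · intro S h
    simp only [mem_filter, mem_powersetCard] at h ⊢
    exact ⟨compl_subset_compl.2 h.2, by rw [card_compl, h.1.2]⟩
  · intro S h
    simp only [mem_filter, mem_powersetCard] at h ⊢
    refine ⟨⟨subset_univ _, ?_⟩, subset_compl_comm.1 h.1⟩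
    rw [card_compl, h.2]
    lia

lemma prod_siteCoeff [Fintype ι] {S T : Finset ι} (hTS : T ⊆ S) (f : ι → Fin 4) :
    ∏ i, siteCoeff S T i (f i) =
      if (univ.filter fun i => f i ≠ 0) ⊆ S then
        (-1) ^ pauliWt f * ((-1) ^ (T ∩ univ.filter fun i => f i ≠ 0).card *
          3 ^ (T.card - (T ∩ univ.filter fun i => f i ≠ 0).card))
      else 0 := by
  set F := univ.filter fun i => f i ≠ 0 with hF
  have hmem : ∀ i, i ∈ F ↔ f i ≠ 0 := by simp [hF]
  split_ifs with h
  · have hcard : T.card - (T ∩ F).card = (T \ F).card := by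
      have := Finset.card_inter_add_card_sdiff T F
      lia
    have hwt : pauliWt f = F.card := rfl
    rw [hcard, hwt]
    have key : ∀ i, siteCoeff S T i (f i) = (if i ∈ F then -1 else 1) *
        ((if i ∈ F ∧ i ∈ T then -1 else 1) * (if i ∈ T ∧ i ∉ F then 3 else 1)) := by
      intro i
      have h1 := hmem i
      have h2 := @h i
      have h3 := @hTS i
      by_cases hi : i ∈ F <;> by_cases hT : i ∈ T <;> by_cases hS : i ∈ S <;>
        by_cases hz : f i = 0 <;> simp_all [siteCoeff]
    have hF' : (univ.filter fun i => i ∈ F) = F := by ext i; simp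
    have hTF : (univ.filter fun i => i ∈ F ∧ i ∈ T) = T ∩ F := by ext i; simp [and_comm]
    have hTF' : (univ.filter fun i => i ∈ T ∧ i ∉ F) = T \ F := by ext i; simp
    simp only [key, prod_mul_distrib, prod_ite, prod_const, one_pow, mul_one, hF', hTF, hTF']
  · obtain ⟨i, hi, hS⟩ := not_subset.1 h
    have hT : i ∉ T := fun hT => hS (hTS hT)
    exact prod_eq_zero (mem_univ i) (by simp [siteCoeff, hS, hT, (hmem i).1 hi])

lemma sum_prod_siteCoeff [Fintype ι] (f : ι → Fin 4) (j : ℕ) {m : ℕ}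
    (hm : m ≤ Fintype.card ι) :
    ∑ S ∈ (univ : Finset ι).powersetCard m, ∑ T ∈ S.powersetCard j,
      ∏ i, siteCoeff S T i (f i) =
      (-1 : ℂ) ^ pauliWt f * (krawtchouk j (pauliWt f) m : ℂ) *
        ((Fintype.card ι - pauliWt f).choose (Fintype.card ι - m) : ℂ) := by
  set F := univ.filter fun i => f i ≠ 0 with hF
  have hwt : pauliWt f = F.card := rfl
  have inner : ∀ S ∈ (univ : Finset ι).powersetCard m,
      ∑ T ∈ S.powersetCard j, ∏ i, siteCoeff S T i (f i) =
        if F ⊆ S then (-1 : ℂ) ^ pauliWt f * (krawtchouk j (pauliWt f) m : ℂ) else 0 := by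
    intro S hS
    have hSc := (mem_powersetCard.1 hS).2
    rw [sum_congr rfl fun T hT => prod_siteCoeff (mem_powersetCard.1 hT).1 f, ← hF]
    split_ifs with h
    · rw [← mul_sum, krawtchouk, Int.cast_sum]
      congr 1
      rw [← sum_fiberwise_of_maps_to (t := range (j + 1)) (g := fun T => (T ∩ F).card)]
      · refine sum_congr rfl fun α hα => ?_
        have hα' : α ≤ j := Nat.lt_succ_iff.1 (mem_range.1 hα)
        rw [sum_congr rfl (g := fun _ => (-1 : ℂ) ^ α * 3 ^ (j - α)), sum_const,
          card_powersetCard_filter_inter h hα', hSc, nsmul_eq_mul, hwt]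
        · push_cast
          ring
        · intro T hT
          obtain ⟨hT, hTα⟩ := mem_filter.1 hT
          rw [hTα, (mem_powersetCard.1 hT).2]
      · intro T hT
        rw [mem_range, Nat.lt_succ_iff, ← (mem_powersetCard.1 hT).2]
        exact card_le_card inter_subset_left
    · simp
  rw [sum_congr rfl inner, ← sum_filter, sum_const, card_powersetCard_filter_superset F hm,
    nsmul_eq_mul, hwt]
  ring

end Counting

open scoped ComplexOrder in
/-- For a positive semidefinite `n`-qubit operator, the averaged shadow
coefficients of the `m`-body reductions are nonnegative:
`∑_{k=0}^{m} (-1)^k K_j(k, m) C(n-k, n-m) A_k(ρ) ≥ 0` for all `0 ≤ j ≤ m ≤ n`. -/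
theorem averaged_shadow_nonneg {n : ℕ}
    (ρ : Matrix (Fin n → Fin 2) (Fin n → Fin 2) ℂ) (hρ : ρ.PosSemidef)
    (j m : ℕ) (hjm : j ≤ m) (hmn : m ≤ n) :
    0 ≤ ∑ k ∈ Finset.range (m + 1),
        (-1 : ℂ) ^ k * (krawtchouk j k m : ℂ) * ((n - k).choose (n - m) : ℂ) *
          weightA ρ k := by
  have hext : ∑ k ∈ Finset.range (m + 1),
        (-1 : ℂ) ^ k * (krawtchouk j k m : ℂ) * ((n - k).choose (n - m) : ℂ) * weightA ρ k =
      ∑ k ∈ Finset.range (n + 1),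
        (-1 : ℂ) ^ k * (krawtchouk j k m : ℂ) * ((n - k).choose (n - m) : ℂ) * weightA ρ k := by
    refine sum_subset (range_subset_range.2 (by lia)) fun k hk hk' => ?_
    rw [mem_range] at hk hk'
    rw [Nat.choose_eq_zero_of_lt (by lia : n - k < n - m)]
    simp
  have hsum : ∑ k ∈ Finset.range (n + 1),
        (-1 : ℂ) ^ k * (krawtchouk j k m : ℂ) * ((n - k).choose (n - m) : ℂ) * weightA ρ k =
      ∑ f : Fin n → Fin 4, ((-1 : ℂ) ^ pauliWt f * (krawtchouk j (pauliWt f) m : ℂ) *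
        ((n - pauliWt f).choose (n - m) : ℂ)) *
          ((pauliOp f * ρ).trace * (pauliOp f * ρ).trace) := by
    rw [← sum_fiberwise_of_maps_to (t := range (n + 1)) (g := pauliWt)]
    · refine sum_congr rfl fun k _ => ?_
      rw [weightA, mul_sum]
      refine sum_congr rfl fun f hf => ?_
      rw [(mem_filter.1 hf).2]
    · intro f _
      rw [mem_range, Nat.lt_succ_iff]
      exact (card_le_univ _).trans_eq (Fintype.card_fin n)
  have hcoeff : ∀ f : Fin n → Fin 4, (-1 : ℂ) ^ pauliWt f * (krawtchouk j (pauliWt f) m : ℂ) *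
      ((n - pauliWt f).choose (n - m) : ℂ) =
      ∑ S ∈ (univ : Finset (Fin n)).powersetCard m, ∑ T ∈ S.powersetCard j,
        ∏ i, siteCoeff S T i (f i) := by
    intro f
    simpa using (sum_prod_siteCoeff f j (m := m) (by simpa using hmn)).symm
  rw [hext, hsum]
  simp only [hcoeff, sum_mul]
  rw [sum_comm]
  refine sum_nonneg fun S _ => ?_
  rw [sum_comm]
  exact sum_nonneg fun T _ =>
    sum_prod_mul_trace_sq_nonneg hρ (siteCoeff S T) (exists_sum_siteCoeff_eq S T)
end
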